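/- arXiv:2407.09903 — 7 statements merged into one kernel-verified Lean document; each statement's English description precedes it below -/
import Mathlib

section
/- For integers 0 ≤ k ≤ n define F_{n,k}(x₁,x₂) = p_n(x₁)p_k(x₂) + p_k(x₁)p_n(x₂) when k < n and F_{n,n}(x₁,x₂) = √2 · p_n(x₁)p_n(x₂). Then: (a) for each pair (n,k) with 0 ≤ k ≤ n there exists a real polynomial P in two variables of total degree n such that F_{n,k}(x₁,x₂) = P(x₁+x₂, x₁x₂) for all (x₁,x₂) ∈ ℝ²; (b) for all 0 ≤ k ≤ n and 0 ≤ j ≤ m, (1/2)∫_{[-1,1]²} F_{n,k}(x₁,x₂) F_{m,j}(x₁,x₂) w(x₁)w(x₂) dx₁dx₂ = 1 if (n,k) = (m,j) and = 0 otherwise. (This expresses that the Koornwinder polynomials P_k^{n,-1/2} form an orthonormal basis of the orthogonal polynomials of degree n for the weight 𝒲_{-1/2}.) -/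
open MeasureTheory Set

/-- The power sum `x₁ ^ m + x₂ ^ m` is a polynomial of degree at most `m` in the elementary
symmetric polynomials. -/
lemma exists_powerSum_eq_eval (m : ℕ) : ∃ P : MvPolynomial (Fin 2) ℝ, P.totalDegree ≤ m ∧
    ∀ x₁ x₂ : ℝ, x₁ ^ m + x₂ ^ m = MvPolynomial.eval ![x₁ + x₂, x₁ * x₂] P := by
  induction m using Nat.twoStepInduction with
  | zero => exact ⟨MvPolynomial.C 2, by simp, fun x₁ x₂ => by simp; norm_num⟩
  | one => exact ⟨MvPolynomial.X 0, by simp, fun x₁ x₂ => by simp⟩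
  | more m ih₀ ih₁ =>
    obtain ⟨P₀, hd₀, hP₀⟩ := ih₀
    obtain ⟨P₁, hd₁, hP₁⟩ := ih₁
    refine ⟨MvPolynomial.X 0 * P₁ - MvPolynomial.X 1 * P₀, ?_, fun x₁ x₂ => ?_⟩
    · refine (MvPolynomial.totalDegree_sub _ _).trans (max_le ?_ ?_)
      · refine (MvPolynomial.totalDegree_mul _ _).trans ?_
        rw [MvPolynomial.totalDegree_X]
        omega
      · refine (MvPolynomial.totalDegree_mul _ _).trans ?_
        rw [MvPolynomial.totalDegree_X]
        omega
    · simp only [map_sub, map_mul, MvPolynomial.eval_X, ← hP₀, ← hP₁, Matrix.cons_val_zero,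
        Matrix.cons_val_one]
      ring

lemma exists_monomialSymm_eq_eval (i j : ℕ) : ∃ P : MvPolynomial (Fin 2) ℝ,
    P.totalDegree ≤ max i j ∧ ∀ x₁ x₂ : ℝ,
      x₁ ^ i * x₂ ^ j + x₁ ^ j * x₂ ^ i = MvPolynomial.eval ![x₁ + x₂, x₁ * x₂] P := by
  wlog h : j ≤ i generalizing i j
  · obtain ⟨P, hd, hP⟩ := this j i (by omega)
    exact ⟨P, max_comm i j ▸ hd, fun x₁ x₂ => by rw [← hP, add_comm]⟩
  obtain ⟨d, rfl⟩ := Nat.exists_eq_add_of_le h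
  obtain ⟨P, hd, hP⟩ := exists_powerSum_eq_eval d
  refine ⟨MvPolynomial.X 1 ^ j * P, ?_, fun x₁ x₂ => ?_⟩
  · refine (MvPolynomial.totalDegree_mul _ _).trans ?_
    rw [MvPolynomial.totalDegree_X_pow]
    omega
  · simp only [map_mul, map_pow, MvPolynomial.eval_X, ← hP, Matrix.cons_val_one]
    simp only [Matrix.cons_val_zero]
    ring

lemma exists_symm_eq_eval {n : ℕ} {p q : Polynomial ℝ} (hp : p.natDegree ≤ n)
    (hq : q.natDegree ≤ n) : ∃ P : MvPolynomial (Fin 2) ℝ, P.totalDegree ≤ n ∧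
      ∀ x₁ x₂ : ℝ, p.eval x₁ * q.eval x₂ + q.eval x₁ * p.eval x₂ =
        MvPolynomial.eval ![x₁ + x₂, x₁ * x₂] P := by
  choose S hS hS' using exists_monomialSymm_eq_eval
  refine ⟨∑ i ∈ Finset.range (n + 1), ∑ j ∈ Finset.range (n + 1),
    MvPolynomial.C (p.coeff i * q.coeff j) * S i j, ?_, fun x₁ x₂ => ?_⟩
  · refine MvPolynomial.totalDegree_finsetSum_le fun i hi =>
      MvPolynomial.totalDegree_finsetSum_le fun j hj => ?_
    rw [Finset.mem_range] at hi hj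
    refine (MvPolynomial.totalDegree_mul _ _).trans ?_
    rw [MvPolynomial.totalDegree_C]
    have := hS i j
    omega
  · simp only [map_sum, map_mul, MvPolynomial.eval_C, ← hS']
    simp only [Polynomial.eval_eq_sum_range' (Nat.lt_succ_of_le hp),
      Polynomial.eval_eq_sum_range' (Nat.lt_succ_of_le hq)]
    rw [Finset.sum_mul_sum, mul_comm (∑ i ∈ _, q.coeff i * x₁ ^ i), Finset.sum_mul_sum,
      ← Finset.sum_add_distrib]
    refine Finset.sum_congr rfl fun i _ => ?_
    rw [← Finset.sum_add_distrib]
    exact Finset.sum_congr rfl fun j _ => by ring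

/-- Substituting polynomials of degree at most one does not raise the degree. -/
lemma natDegree_aeval_le_totalDegree {σ : Type*} (P : MvPolynomial σ ℝ) {f : σ → Polynomial ℝ}
    (hf : ∀ i, (f i).natDegree ≤ 1) : (MvPolynomial.aeval f P).natDegree ≤ P.totalDegree := by
  rw [MvPolynomial.aeval_def, MvPolynomial.eval₂_eq]
  refine Polynomial.natDegree_sum_le_of_forall_le _ _ fun d hd => ?_
  refine (Polynomial.natDegree_C_mul_le _ _).trans ?_
  refine (Polynomial.natDegree_prod_le _ _).trans (le_trans ?_ (MvPolynomial.le_totalDegree hd))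
  refine Finset.sum_le_sum fun i _ => Polynomial.natDegree_pow_le.trans ?_
  simpa using Nat.mul_le_mul_left (d i) (hf i)

/-- A polynomial in `x₁ + x₂` and `x₁ * x₂` has total degree at least its degree in `x₁` for
fixed `x₂`. -/
lemma natDegree_le_totalDegree_of_eval_eq {P : MvPolynomial (Fin 2) ℝ} {r : Polynomial ℝ} (c : ℝ)
    (h : ∀ x, r.eval x = MvPolynomial.eval ![x + c, x * c] P) :
    r.natDegree ≤ P.totalDegree := by
  let f : Fin 2 → Polynomial ℝ :=
    ![Polynomial.X + Polynomial.C c, Polynomial.X * Polynomial.C c]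
  have hr : r = MvPolynomial.aeval f P := by
    refine Polynomial.funext fun x => ?_
    rw [h, ← Polynomial.coe_aeval_eq_eval, ← AlgHom.comp_apply, MvPolynomial.comp_aeval,
      ← MvPolynomial.coe_aeval_eq_eval]
    have : ![x + c, x * c] = fun i => Polynomial.aeval x (f i) := by
      funext i
      fin_cases i <;> simp [f] <;> ring
    rw [this]
    rfl
  rw [hr]
  refine natDegree_aeval_le_totalDegree P fun i => ?_
  fin_cases i
  · exact (Polynomial.natDegree_X_add_C c).le
  · exact (Polynomial.natDegree_mul_C_le _ _).trans Polynomial.natDegree_X_le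

lemma integral_symm_mul_symm {w : ℝ → ℝ} (hw : IntegrableOn w (Icc (-1 : ℝ) 1))
    {p : ℕ → Polynomial ℝ}
    (horth : ∀ i j, (∫ t in Icc (-1 : ℝ) 1, (p i).eval t * (p j).eval t * w t)
      = if i = j then 1 else 0) (n k m j : ℕ) :
    ∫ x in (Icc (-1 : ℝ) 1) ×ˢ (Icc (-1 : ℝ) 1),
      ((p n).eval x.1 * (p k).eval x.2 + (p k).eval x.1 * (p n).eval x.2) *
      ((p m).eval x.1 * (p j).eval x.2 + (p j).eval x.1 * (p m).eval x.2) *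
        (w x.1 * w x.2) =
      2 * ((if n = m then 1 else 0) * (if k = j then 1 else 0) +
        (if n = j then 1 else 0) * (if k = m then 1 else 0)) := by
  let g (a b : ℕ) (t : ℝ) : ℝ := (p a).eval t * (p b).eval t * w t
  have hg (a b : ℕ) : IntegrableOn (g a b) (Icc (-1 : ℝ) 1) :=
    hw.continuousOn_mul (by fun_prop) isCompact_Icc
  have hint (a b c d : ℕ) : IntegrableOn (fun x : ℝ × ℝ => g a b x.1 * g c d x.2)
      (Icc (-1 : ℝ) 1 ×ˢ Icc (-1 : ℝ) 1) := by
    rw [IntegrableOn, Measure.volume_eq_prod, ← Measure.prod_restrict]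
    exact (hg a b).mul_prod (hg c d)
  have hint_add (a b c d a' b' c' d' : ℕ) : IntegrableOn
      (fun x : ℝ × ℝ => g a b x.1 * g c d x.2 + g a' b' x.1 * g c' d' x.2)
      (Icc (-1 : ℝ) 1 ×ˢ Icc (-1 : ℝ) 1) :=
    (hint a b c d).add (hint a' b' c' d')
  have hval (a b c d : ℕ) : ∫ x in Icc (-1 : ℝ) 1 ×ˢ Icc (-1 : ℝ) 1, g a b x.1 * g c d x.2 =
      (if a = b then 1 else 0) * (if c = d then 1 else 0) := by
    rw [Measure.volume_eq_prod, setIntegral_prod_mul, horth, horth]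
  have hexp : (fun x : ℝ × ℝ =>
      ((p n).eval x.1 * (p k).eval x.2 + (p k).eval x.1 * (p n).eval x.2) *
      ((p m).eval x.1 * (p j).eval x.2 + (p j).eval x.1 * (p m).eval x.2) *
        (w x.1 * w x.2)) = fun x =>
      (g n m x.1 * g k j x.2 + g n j x.1 * g k m x.2) +
      (g k m x.1 * g n j x.2 + g k j x.1 * g n m x.2) := by
    funext x
    simp only [g]
    ring
  rw [hexp, integral_add (hint_add _ _ _ _ _ _ _ _) (hint_add _ _ _ _ _ _ _ _),
    integral_add (hint _ _ _ _) (hint _ _ _ _), integral_add (hint _ _ _ _) (hint _ _ _ _)]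
  simp only [hval]
  ring

theorem stmt1 (w : ℝ → ℝ)
    (hw_nonneg : ∀ t ∈ Icc (-1:ℝ) 1, 0 ≤ w t)
    (hw_int : IntegrableOn w (Icc (-1:ℝ) 1))
    (hw_ne : ¬ (w =ᵐ[volume.restrict (Icc (-1:ℝ) 1)] 0))
    (p : ℕ → Polynomial ℝ)
    (hdeg : ∀ j, (p j).natDegree = j)
    (horth : ∀ i j, (∫ t in Icc (-1:ℝ) 1, (p i).eval t * (p j).eval t * w t)
      = if i = j then 1 else 0)
    (F : ℕ → ℕ → ℝ → ℝ → ℝ)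
    (hFlt : ∀ n k, k < n → ∀ x₁ x₂ : ℝ, F n k x₁ x₂ =
      (p n).eval x₁ * (p k).eval x₂ + (p k).eval x₁ * (p n).eval x₂)
    (hFeq : ∀ n, ∀ x₁ x₂ : ℝ, F n n x₁ x₂ =
      Real.sqrt 2 * ((p n).eval x₁ * (p n).eval x₂)) :
    -- (a) `F n k` is a polynomial of total degree `n` in `(x₁+x₂, x₁x₂)`
    (∀ n k, k ≤ n → ∃ P : MvPolynomial (Fin 2) ℝ, P.totalDegree = n ∧
      ∀ x₁ x₂ : ℝ, F n k x₁ x₂ = MvPolynomial.eval ![x₁ + x₂, x₁ * x₂] P) ∧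
    -- (b) orthonormality
    (∀ n k m j, k ≤ n → j ≤ m →
      (1/2) * ∫ x in (Icc (-1:ℝ) 1) ×ˢ (Icc (-1:ℝ) 1),
        F n k x.1 x.2 * F m j x.1 x.2 * (w x.1 * w x.2) =
      if (n, k) = (m, j) then (1:ℝ) else 0) := by
  let c (n k : ℕ) : ℝ := if k < n then 1 else √2 / 2
  have hc (n k : ℕ) : c n k ≠ 0 := by
    simp only [c]
    split_ifs <;> positivity
  have hF (n k : ℕ) (hk : k ≤ n) (x₁ x₂ : ℝ) : F n k x₁ x₂ =
      c n k * ((p n).eval x₁ * (p k).eval x₂ + (p k).eval x₁ * (p n).eval x₂) := by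
    rcases hk.lt_or_eq with h | rfl
    · simp only [c, if_pos h, hFlt n k h, one_mul]
    · simp only [c, lt_irrefl, if_false, hFeq]
      ring
  have hp (k : ℕ) : p k ≠ 0 := by
    intro h
    simpa [h] using horth k k
  refine ⟨fun n k hk => ?_, fun n k m j hk hj => ?_⟩
  · obtain ⟨P, hd, hP⟩ := exists_symm_eq_eval (hdeg n).le ((hdeg k).le.trans hk)
    refine ⟨MvPolynomial.C (c n k) * P, le_antisymm ?_ ?_, fun x₁ x₂ => ?_⟩
    · refine (MvPolynomial.totalDegree_mul _ _).trans ?_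
      rwa [MvPolynomial.totalDegree_C, zero_add]
    · obtain ⟨a, ha⟩ : ∃ a, (p k).eval a ≠ 0 := by
        by_contra! h
        exact hp k (Polynomial.funext fun x => by simp [h x])
      let r : Polynomial ℝ := Polynomial.C (c n k) *
        (Polynomial.C ((p k).eval a) * p n + Polynomial.C ((p n).eval a) * p k)
      have hr : r.natDegree = n := by
        simp only [r]
        rw [Polynomial.natDegree_C_mul (hc n k)]
        rcases hk.lt_or_eq with h | rfl
        · rw [Polynomial.natDegree_add_eq_left_of_natDegree_lt, Polynomial.natDegree_C_mul ha, hdeg]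
          refine (Polynomial.natDegree_C_mul_le _ _).trans_lt ?_
          rwa [Polynomial.natDegree_C_mul ha, hdeg, hdeg]
        · rw [← two_mul, ← mul_assoc, ← Polynomial.C_ofNat, ← Polynomial.C_mul,
            Polynomial.natDegree_C_mul (mul_ne_zero two_ne_zero ha), hdeg]
      calc n = r.natDegree := hr.symm
        _ ≤ _ := natDegree_le_totalDegree_of_eval_eq a fun x => by
          rw [map_mul, MvPolynomial.eval_C, ← hP]
          simp only [r, Polynomial.eval_mul, Polynomial.eval_add, Polynomial.eval_C]
          ring
    · rw [map_mul, MvPolynomial.eval_C, ← hP, hF n k hk]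
  · have hFF : (fun x : ℝ × ℝ => F n k x.1 x.2 * F m j x.1 x.2 * (w x.1 * w x.2)) =
        fun x => c n k * c m j *
          (((p n).eval x.1 * (p k).eval x.2 + (p k).eval x.1 * (p n).eval x.2) *
          ((p m).eval x.1 * (p j).eval x.2 + (p j).eval x.1 * (p m).eval x.2) *
            (w x.1 * w x.2)) := by
      funext x
      rw [hF n k hk, hF m j hj]
      ring
    rw [hFF, integral_const_mul, integral_symm_mul_symm hw_int horth]
    have h2 : √2 * √2 = (2 : ℝ) := Real.mul_self_sqrt zero_le_two
    by_cases h : n = m ∧ k = j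
    · obtain ⟨rfl, rfl⟩ := h
      rcases hk.lt_or_eq with h | rfl
      · simp [c, h, h.ne, h.ne']
      · simp only [c, lt_irrefl, if_true, if_false]
        linarith
    · have h₁ : (if n = m then (1 : ℝ) else 0) * (if k = j then 1 else 0) = 0 := by
        grind
      have h₂ : (if n = j then (1 : ℝ) else 0) * (if k = m then 1 else 0) = 0 := by
        grind
      rw [h₁, h₂, if_neg (by simpa using h)]
      ring
end

section
/- For integers 0 ≤ k ≤ n define G_{n,k}(x₁,x₂) = p_{n+1}(x₁)p_k(x₂) − p_{n+1}(x₂)p_k(x₁). Then: (a) for each pair (n,k) with 0 ≤ k ≤ n there exists a real polynomial Q in two variables of total degree n such that G_{n,k}(x₁,x₂) = (x₁−x₂)·Q(x₁+x₂, x₁x₂) for all (x₁,x₂) ∈ ℝ²; (b) for all 0 ≤ k ≤ n and 0 ≤ j ≤ m, (1/2)∫_{[-1,1]²} G_{n,k}(x₁,x₂) G_{m,j}(x₁,x₂) w(x₁)w(x₂) dx₁dx₂ = 1 if (n,k) = (m,j) and = 0 otherwise. (This expresses that the Koornwinder polynomials P_k^{n,1/2} form an orthonormal basis of the orthogonal polynomials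 of degree n for the weight 𝒲_{1/2}.) -/
open MeasureTheory Set

/-- `x ^ (d + 1) - y ^ (d + 1)` is `x - y` times a polynomial of total degree at most `d` in the
elementary symmetric functions of `x` and `y`. -/
lemma exists_mvPolynomial_pow_succ_sub_pow_succ (d : ℕ) :
    ∃ Q : MvPolynomial (Fin 2) ℝ, Q.totalDegree ≤ d ∧
      ∀ x y : ℝ, x ^ (d + 1) - y ^ (d + 1)
        = (x - y) * MvPolynomial.eval ![x + y, x * y] Q := by
  induction d using Nat.twoStepInduction with
  | zero => exact ⟨1, by simp, fun x y => by simp⟩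
  | one =>
    exact ⟨MvPolynomial.X 0, by simp, fun x y => by simp; ring⟩
  | more d ih₀ ih₁ =>
    obtain ⟨Q₀, h₀, e₀⟩ := ih₀
    obtain ⟨Q₁, h₁, e₁⟩ := ih₁
    refine ⟨MvPolynomial.X 0 * Q₁ - MvPolynomial.X 1 * Q₀, ?_, fun x y => ?_⟩
    · refine (MvPolynomial.totalDegree_sub _ _).trans (max_le ?_ ?_)
      · refine (MvPolynomial.totalDegree_mul _ _).trans ?_
        rw [MvPolynomial.totalDegree_X]; omega
      · refine (MvPolynomial.totalDegree_mul _ _).trans ?_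
        rw [MvPolynomial.totalDegree_X]; omega
    · simp only [map_sub, map_mul, MvPolynomial.eval_X, Matrix.cons_val_zero, Matrix.cons_val_one]
      linear_combination (x + y) * e₁ x y - x * y * e₀ x y

lemma exists_mvPolynomial_pow_mul_pow_sub_of_lt {N i j : ℕ} (hij : j < i) (hi : i ≤ N + 1) :
    ∃ Q : MvPolynomial (Fin 2) ℝ, Q.totalDegree ≤ N ∧
      ∀ x y : ℝ, x ^ i * y ^ j - y ^ i * x ^ j
        = (x - y) * MvPolynomial.eval ![x + y, x * y] Q := by
  obtain ⟨d, rfl⟩ := Nat.exists_eq_add_of_lt hij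
  obtain ⟨Q, hQ, e⟩ := exists_mvPolynomial_pow_succ_sub_pow_succ d
  refine ⟨MvPolynomial.X 1 ^ j * Q, ?_, fun x y => ?_⟩
  · refine (MvPolynomial.totalDegree_mul _ _).trans ?_
    rw [MvPolynomial.totalDegree_X_pow]; omega
  · simp only [map_pow, map_mul, MvPolynomial.eval_X, Matrix.cons_val_one]
    rw [mul_left_comm, ← e]
    simp only [Matrix.cons_val_fin_one]
    ring

lemma exists_mvPolynomial_pow_mul_pow_sub {N i j : ℕ} (hi : i ≤ N + 1) (hj : j ≤ N + 1) :
    ∃ Q : MvPolynomial (Fin 2) ℝ, Q.totalDegree ≤ N ∧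
      ∀ x y : ℝ, x ^ i * y ^ j - y ^ i * x ^ j
        = (x - y) * MvPolynomial.eval ![x + y, x * y] Q := by
  rcases lt_trichotomy j i with h | rfl | h
  · exact exists_mvPolynomial_pow_mul_pow_sub_of_lt h hi
  · exact ⟨0, by simp, fun x y => by simp; ring⟩
  · obtain ⟨Q, hQ, e⟩ := exists_mvPolynomial_pow_mul_pow_sub_of_lt h hj
    refine ⟨-Q, by rwa [MvPolynomial.totalDegree_neg], fun x y => ?_⟩
    rw [map_neg]
    linear_combination -e x y

/-- An antisymmetrized product of univariate polynomials of degree at most `N + 1` is `x - y` times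
a polynomial of total degree at most `N` in the elementary symmetric functions. -/
lemma exists_mvPolynomial_eval_mul_eval_sub {N : ℕ} {f g : Polynomial ℝ}
    (hf : f.natDegree ≤ N + 1) (hg : g.natDegree ≤ N + 1) :
    ∃ Q : MvPolynomial (Fin 2) ℝ, Q.totalDegree ≤ N ∧
      ∀ x y : ℝ, f.eval x * g.eval y - f.eval y * g.eval x
        = (x - y) * MvPolynomial.eval ![x + y, x * y] Q := by
  have key : ∀ i j : ℕ, ∃ Q : MvPolynomial (Fin 2) ℝ, i ≤ N + 1 → j ≤ N + 1 →
      Q.totalDegree ≤ N ∧ ∀ x y : ℝ, x ^ i * y ^ j - y ^ i * x ^ j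
        = (x - y) * MvPolynomial.eval ![x + y, x * y] Q := by
    intro i j
    by_cases h : i ≤ N + 1 ∧ j ≤ N + 1
    · obtain ⟨Q, hQ⟩ := exists_mvPolynomial_pow_mul_pow_sub h.1 h.2
      exact ⟨Q, fun _ _ => hQ⟩
    · exact ⟨0, fun h₁ h₂ => absurd ⟨h₁, h₂⟩ h⟩
  choose Q hQ using key
  refine ⟨∑ i ∈ Finset.range (N + 2), ∑ j ∈ Finset.range (N + 2),
    MvPolynomial.C (f.coeff i * g.coeff j) * Q i j, ?_, fun x y => ?_⟩
  · refine MvPolynomial.totalDegree_finsetSum_le fun i hi => ?_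
    refine MvPolynomial.totalDegree_finsetSum_le fun j hj => ?_
    rw [Finset.mem_range] at hi hj
    refine (MvPolynomial.totalDegree_mul _ _).trans ?_
    rw [MvPolynomial.totalDegree_C, zero_add]
    exact (hQ i j (by omega) (by omega)).1
  · have hf' := fun x => Polynomial.eval_eq_sum_range' (show f.natDegree < N + 2 by omega) x
    have hg' := fun x => Polynomial.eval_eq_sum_range' (show g.natDegree < N + 2 by omega) x
    rw [hf' x, hf' y, hg' x, hg' y, Finset.sum_mul_sum, Finset.sum_mul_sum,
      ← Finset.sum_sub_distrib, map_sum, Finset.mul_sum]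
    refine Finset.sum_congr rfl fun i hi => ?_
    rw [← Finset.sum_sub_distrib, map_sum, Finset.mul_sum]
    refine Finset.sum_congr rfl fun j hj => ?_
    rw [Finset.mem_range] at hi hj
    rw [map_mul, MvPolynomial.eval_C]
    linear_combination f.coeff i * g.coeff j * (hQ i j (by omega) (by omega)).2 x y

lemma natDegree_aeval_le_totalDegree_s2 {σ : Type*} (Q : MvPolynomial σ ℝ) (v : σ → Polynomial ℝ)
    (hv : ∀ s, (v s).natDegree ≤ 1) :
    (MvPolynomial.aeval v Q).natDegree ≤ Q.totalDegree := by
  rw [MvPolynomial.aeval_def, MvPolynomial.eval₂_eq]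
  refine Polynomial.natDegree_sum_le_of_forall_le _ _ fun d hd => ?_
  refine (Polynomial.natDegree_C_mul_le _ _).trans ?_
  refine (Polynomial.natDegree_prod_le _ _).trans ?_
  refine le_trans (Finset.sum_le_sum fun s _ => ?_) (MvPolynomial.le_totalDegree hd)
  exact Polynomial.natDegree_pow_le.trans (by nlinarith [hv s, Nat.zero_le (d s)])

/-- A polynomial `Q` in the elementary symmetric functions representing the antisymmetrized product
of `f` and `g` divided by `x - y` has total degree at least `deg f - 1`. -/
lemma le_totalDegree_of_eval_mul_eval_sub {n : ℕ} {f g : Polynomial ℝ}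
    (hf : f.natDegree = n + 1) (hg : g.natDegree ≤ n) (hg₀ : g ≠ 0)
    {Q : MvPolynomial (Fin 2) ℝ}
    (hQ : ∀ x y : ℝ, f.eval x * g.eval y - f.eval y * g.eval x
        = (x - y) * MvPolynomial.eval ![x + y, x * y] Q) :
    n ≤ Q.totalDegree := by
  obtain ⟨y, hy⟩ : ∃ y, g.eval y ≠ 0 := by
    by_contra! h
    exact hg₀ (Polynomial.funext fun y => by simpa using h y)
  set F : Polynomial ℝ := MvPolynomial.aeval
    ![Polynomial.X + Polynomial.C y, Polynomial.X * Polynomial.C y] Q with hF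
  have hF_le : F.natDegree ≤ Q.totalDegree := by
    refine natDegree_aeval_le_totalDegree_s2 Q _ fun s => ?_
    fin_cases s
    · simp
    · exact (Polynomial.natDegree_mul_C_le _ _).trans (by simp)
  have hF_eval : ∀ x, F.eval x = MvPolynomial.eval ![x + y, x * y] Q := by
    intro x
    have h := MvPolynomial.map_aeval (R := ℝ)
      ![Polynomial.X + Polynomial.C y, Polynomial.X * Polynomial.C y] (Polynomial.evalRingHom x) Q
    rw [← hF, Polynomial.coe_evalRingHom] at h
    rw [h, MvPolynomial.coe_eval₂Hom, MvPolynomial.eval, MvPolynomial.coe_eval₂Hom]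
    congr 1
    · ext; simp
    · funext s
      fin_cases s <;> (simp; try ring)
  have hmul : f * Polynomial.C (g.eval y) - Polynomial.C (f.eval y) * g
      = (Polynomial.X - Polynomial.C y) * F := by
    refine Polynomial.funext fun x => ?_
    simp [hF_eval, hQ]
  have hcoeff : (f * Polynomial.C (g.eval y) - Polynomial.C (f.eval y) * g).coeff (n + 1) ≠ 0 := by
    rw [Polynomial.coeff_sub, Polynomial.coeff_mul_C, Polynomial.coeff_C_mul,
      Polynomial.coeff_eq_zero_of_natDegree_lt (p := g) (by omega), mul_zero, sub_zero]
    refine mul_ne_zero ?_ hy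
    rw [← hf, Polynomial.coeff_natDegree, Polynomial.leadingCoeff_ne_zero]
    rintro rfl
    simp at hf
  rw [hmul] at hcoeff
  have h₁ := Polynomial.le_natDegree_of_ne_zero hcoeff
  have h₂ := Polynomial.natDegree_mul_le (p := Polynomial.X - Polynomial.C y) (q := F)
  rw [Polynomial.natDegree_X_sub_C] at h₂
  omega

lemma integrableOn_Icc_eval_mul_eval_mul {w : ℝ → ℝ} {a b : ℝ} (hw : IntegrableOn w (Icc a b))
    (f g : Polynomial ℝ) :
    IntegrableOn (fun t => f.eval t * g.eval t * w t) (Icc a b) :=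
  hw.continuousOn_mul (by fun_prop) isCompact_Icc

/-- The integral of a product of two antisymmetrized products is twice a `2 × 2` Gram
determinant. -/
lemma setIntegral_antisymm_mul_antisymm {w : ℝ → ℝ} {a b : ℝ} (hw : IntegrableOn w (Icc a b))
    (f g f' g' : Polynomial ℝ) :
    ∫ x in Icc a b ×ˢ Icc a b,
      (f.eval x.1 * g.eval x.2 - f.eval x.2 * g.eval x.1) *
        (f'.eval x.1 * g'.eval x.2 - f'.eval x.2 * g'.eval x.1) * (w x.1 * w x.2)
      = 2 * ((∫ t in Icc a b, f.eval t * f'.eval t * w t)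
            * (∫ t in Icc a b, g.eval t * g'.eval t * w t)
          - (∫ t in Icc a b, f.eval t * g'.eval t * w t)
            * ∫ t in Icc a b, g.eval t * f'.eval t * w t) := by
  let φ : Polynomial ℝ → Polynomial ℝ → ℝ → ℝ := fun f g t => f.eval t * g.eval t * w t
  have hint : ∀ p q r s : Polynomial ℝ, Integrable (fun x : ℝ × ℝ => φ p q x.1 * φ r s x.2)
      (volume.restrict (Icc a b ×ˢ Icc a b)) := by
    intro p q r s
    rw [Measure.volume_eq_prod, ← Measure.prod_restrict]
    exact (integrableOn_Icc_eval_mul_eval_mul hw p q).mul_prod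
      (integrableOn_Icc_eval_mul_eval_mul hw r s)
  have hprod : ∀ p q r s : Polynomial ℝ,
      ∫ x in Icc a b ×ˢ Icc a b, φ p q x.1 * φ r s x.2
        = (∫ t in Icc a b, φ p q t) * ∫ t in Icc a b, φ r s t := by
    intro p q r s
    rw [Measure.volume_eq_prod]
    exact setIntegral_prod_mul _ _ _ _
  calc
    _ = ∫ x in Icc a b ×ˢ Icc a b, (φ f f' x.1 * φ g g' x.2 + φ g g' x.1 * φ f f' x.2
          - (φ f g' x.1 * φ g f' x.2 + φ g f' x.1 * φ f g' x.2)) := by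
      congr 1
      funext x
      simp only [φ]
      ring
    _ = _ := by
      rw [integral_sub (by exact (hint _ _ _ _).add (hint _ _ _ _))
          (by exact (hint _ _ _ _).add (hint _ _ _ _)),
        integral_add (hint _ _ _ _) (hint _ _ _ _), integral_add (hint _ _ _ _) (hint _ _ _ _),
        hprod, hprod, hprod, hprod]
      simp only [φ]
      ring

theorem stmt2 (w : ℝ → ℝ)
    (hw_nonneg : ∀ t ∈ Icc (-1:ℝ) 1, 0 ≤ w t)
    (hw_int : IntegrableOn w (Icc (-1:ℝ) 1))
    (hw_ne : ¬ (w =ᵐ[volume.restrict (Icc (-1:ℝ) 1)] 0))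
    (p : ℕ → Polynomial ℝ)
    (hdeg : ∀ j, (p j).natDegree = j)
    (horth : ∀ i j, (∫ t in Icc (-1:ℝ) 1, (p i).eval t * (p j).eval t * w t)
      = if i = j then 1 else 0)
    (G : ℕ → ℕ → ℝ → ℝ → ℝ)
    (hG : ∀ n k, k ≤ n → ∀ x₁ x₂ : ℝ, G n k x₁ x₂ =
      (p (n+1)).eval x₁ * (p k).eval x₂ - (p (n+1)).eval x₂ * (p k).eval x₁) :
    -- (a) `G n k = (x₁−x₂)·Q(x₁+x₂, x₁x₂)` for a polynomial `Q` of total degree `n`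
    (∀ n k, k ≤ n → ∃ Q : MvPolynomial (Fin 2) ℝ, Q.totalDegree = n ∧
      ∀ x₁ x₂ : ℝ, G n k x₁ x₂ = (x₁ - x₂) * MvPolynomial.eval ![x₁ + x₂, x₁ * x₂] Q) ∧
    -- (b) orthonormality
    (∀ n k m j, k ≤ n → j ≤ m →
      (1/2) * ∫ x in (Icc (-1:ℝ) 1) ×ˢ (Icc (-1:ℝ) 1),
        G n k x.1 x.2 * G m j x.1 x.2 * (w x.1 * w x.2) =
      if (n, k) = (m, j) then (1:ℝ) else 0) := by
  refine ⟨fun n k hk => ?_, fun n k m j hk hj => ?_⟩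
  · have hp₀ : p k ≠ 0 := by
      intro h
      have := horth k k
      simp [h] at this
    have hfk : (p k).natDegree ≤ n := (hdeg k).trans_le hk
    obtain ⟨Q, hQ, e⟩ := exists_mvPolynomial_eval_mul_eval_sub (N := n) (f := p (n + 1)) (g := p k)
      (hdeg _).le (by omega)
    exact ⟨Q, hQ.antisymm (le_totalDegree_of_eval_mul_eval_sub (hdeg _) hfk hp₀ e),
      fun x₁ x₂ => (hG n k hk x₁ x₂).trans (e x₁ x₂)⟩
  · simp only [hG n k hk, hG m j hj]
    rw [setIntegral_antisymm_mul_antisymm hw_int, horth, horth, horth, horth]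
    have hcross : ¬ (n + 1 = j ∧ k = m + 1) := by omega
    have hcross' : (if n + 1 = j then (1 : ℝ) else 0) * (if k = m + 1 then 1 else 0) = 0 := by
      split_ifs <;> simp_all
    rw [hcross']
    by_cases h₁ : n = m <;> by_cases h₂ : k = j <;> simp [h₁, h₂]
end

section
/- For every real polynomial F in two variables of total degree ≤ 2n−1, ∫_{[-1,1]²} F(x₁+x₂, x₁x₂) w(x₁)w(x₂) dx₁dx₂ = Σ_{j=1}^{n} Σ_{k=1}^{n} λ_j λ_k F(t_j+t_k, t_j t_k). Moreover the points {(t_j+t_k, t_j t_k) : 1 ≤ j ≤ k ≤ n} are pairwise distinct, so this is (under the change of variables u = (x₁+x₂, x₁x₂)) a cubature rule of degree 2n−1 for the weight 𝒲_{-1/2} on Ω with exactly n(n+1)/2 nodes, i.e. a Gauss cubature rule attaining the lower bound dim Π²_{n-1} = n(n+1)/2. -/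
open MeasureTheory Set

/-- A one-dimensional quadrature rule of degree `d` integrates, after taking the product with
itself, every polynomial of degree at most `d` in the elementary symmetric functions. -/
theorem integral_prod_eval_symm_eq_sum {ι : Type*} [Fintype ι] {w : ℝ → ℝ} {S : Set ℝ} {d : ℕ}
    {t lam : ι → ℝ} (hint : ∀ m : ℕ, IntegrableOn (fun s => s ^ m * w s) S)
    (hmom : ∀ m ≤ d, (∫ s in S, s ^ m * w s) = ∑ k, lam k * t k ^ m)
    (F : MvPolynomial (Fin 2) ℝ) (hF : F.totalDegree ≤ d) :
    (∫ x in S ×ˢ S, MvPolynomial.eval ![x.1 + x.2, x.1 * x.2] F * (w x.1 * w x.2)) =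
      ∑ j, ∑ k, lam j * lam k * MvPolynomial.eval ![t j + t k, t j * t k] F := by
  have expand : ∀ x y : ℝ, MvPolynomial.eval ![x + y, x * y] F =
      ∑ e ∈ F.support, ∑ i ∈ Finset.range (e 0 + 1),
        F.coeff e * (e 0).choose i * (x ^ (i + e 1) * y ^ (e 0 - i + e 1)) := by
    intro x y
    rw [MvPolynomial.eval_eq']
    refine Finset.sum_congr rfl fun e _ => ?_
    simp only [Fin.prod_univ_two, Matrix.cons_val_zero, Matrix.cons_val_one, add_pow,
      Finset.sum_mul, Finset.mul_sum]
    refine Finset.sum_congr rfl fun i _ => ?_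
    rw [mul_pow, pow_add, pow_add]
    ring
  have hprod : ∀ p q : ℕ, Integrable (fun x : ℝ × ℝ => (x.1 ^ p * w x.1) * (x.2 ^ q * w x.2))
      (volume.restrict (S ×ˢ S)) := by
    intro p q
    rw [Measure.volume_eq_prod, ← Measure.prod_restrict]
    exact (hint p).mul_prod (hint q)
  have hterm : ∀ (x : ℝ × ℝ), MvPolynomial.eval ![x.1 + x.2, x.1 * x.2] F * (w x.1 * w x.2) =
      ∑ e ∈ F.support, ∑ i ∈ Finset.range (e 0 + 1), F.coeff e * (e 0).choose i *
        ((x.1 ^ (i + e 1) * w x.1) * (x.2 ^ (e 0 - i + e 1) * w x.2)) := by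
    intro x
    simp only [expand, Finset.sum_mul]
    refine Finset.sum_congr rfl fun e _ => Finset.sum_congr rfl fun i _ => ?_
    ring
  simp only [hterm]
  rw [integral_finsetSum _ fun e _ => integrable_finsetSum _ fun i _ =>
    (hprod _ _).const_mul _]
  have hswap : ∑ j, ∑ k, lam j * lam k * MvPolynomial.eval ![t j + t k, t j * t k] F =
      ∑ e ∈ F.support, ∑ i ∈ Finset.range (e 0 + 1), F.coeff e * (e 0).choose i *
        ((∑ j, lam j * t j ^ (i + e 1)) * ∑ k, lam k * t k ^ (e 0 - i + e 1)) := by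
    simp only [expand, Finset.mul_sum (s := F.support), Finset.mul_sum (s := Finset.range _)]
    simp_rw [Finset.sum_comm (s := Finset.univ) (t := F.support)]
    refine Finset.sum_congr rfl fun e _ => ?_
    simp_rw [Finset.sum_comm (s := Finset.univ) (t := Finset.range (e 0 + 1))]
    refine Finset.sum_congr rfl fun i _ => ?_
    rw [Finset.sum_mul_sum, Finset.mul_sum]
    refine Finset.sum_congr rfl fun j _ => ?_
    rw [Finset.mul_sum]
    refine Finset.sum_congr rfl fun k _ => ?_
    ring
  rw [hswap]
  refine Finset.sum_congr rfl fun e he => ?_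
  rw [integral_finsetSum _ fun i _ => (hprod _ _).const_mul _]
  refine Finset.sum_congr rfl fun i hi => ?_
  have hdeg : e 0 + e 1 ≤ d := by
    have h := (MvPolynomial.le_totalDegree he).trans hF
    rwa [Finsupp.sum_fintype _ _ fun _ => rfl, Fin.sum_univ_two] at h
  have hi' := Finset.mem_range.mp hi
  rw [integral_const_mul, Measure.volume_eq_prod,
    setIntegral_prod_mul (fun x => x ^ (i + e 1) * w x) (fun y => y ^ (e 0 - i + e 1) * w y),
    hmom _ (by omega), hmom _ (by omega)]

/-- The elementary symmetric functions separate unordered pairs. -/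
theorem injOn_add_mul_of_injective {ι R : Type*} [PartialOrder ι] [CommRing R] [IsDomain R]
    {t : ι → R} (ht : Function.Injective t) :
    Set.InjOn (fun q : ι × ι => (t q.1 + t q.2, t q.1 * t q.2)) {q : ι × ι | q.1 ≤ q.2} := by
  rintro ⟨a, b⟩ (hab : a ≤ b) ⟨c, d⟩ (hcd : c ≤ d) h
  obtain ⟨hs, hp⟩ := Prod.mk.inj h
  dsimp only at hs hp
  have hroot : (t a - t c) * (t a - t d) = 0 := by linear_combination t a * hs - hp
  rcases mul_eq_zero.mp hroot with h0 | h0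
  · have hac : a = c := ht (sub_eq_zero.mp h0)
    have hbd : b = d := ht (by linear_combination hs - h0)
    rw [hac, hbd]
  · have had : a = d := ht (sub_eq_zero.mp h0)
    have hbc : b = c := ht (by linear_combination hs - h0)
    subst had hbc
    rw [le_antisymm hab hcd]

theorem stmt3 (w : ℝ → ℝ)
    (hw_nonneg : ∀ t ∈ Icc (-1:ℝ) 1, 0 ≤ w t)
    (hw_int : IntegrableOn w (Icc (-1:ℝ) 1))
    (hw_ne : ¬ (w =ᵐ[volume.restrict (Icc (-1:ℝ) 1)] 0))
    (n : ℕ) (hn : 1 ≤ n)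
    (t : Fin n → ℝ) (lam : Fin n → ℝ)
    (ht : ∀ k, t k ∈ Ioo (-1:ℝ) 1) (htinj : Function.Injective t)
    (hlam : ∀ k, 0 < lam k)
    (hquad : ∀ g : Polynomial ℝ, g.natDegree ≤ 2*n - 1 →
      (∫ s in Icc (-1:ℝ) 1, g.eval s * w s) = ∑ k, lam k * g.eval (t k)) :
    -- the Gauss cubature rule of degree 2n−1 for 𝒲_{−1/2}
    (∀ F : MvPolynomial (Fin 2) ℝ, F.totalDegree ≤ 2*n - 1 →
      (∫ x in (Icc (-1:ℝ) 1) ×ˢ (Icc (-1:ℝ) 1),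
        MvPolynomial.eval ![x.1 + x.2, x.1 * x.2] F * (w x.1 * w x.2)) =
      ∑ j, ∑ k, lam j * lam k * MvPolynomial.eval ![t j + t k, t j * t k] F) ∧
    -- the n(n+1)/2 nodes (u_{jk}, v_{jk}) for j ≤ k are pairwise distinct
    Set.InjOn (fun q : Fin n × Fin n => (t q.1 + t q.2, t q.1 * t q.2))
      {q : Fin n × Fin n | q.1 ≤ q.2} := by
  refine ⟨integral_prod_eval_symm_eq_sum (fun m => ?_) fun m hm => ?_,
    injOn_add_mul_of_injective htinj⟩
  · exact hw_int.continuousOn_mul (continuous_pow m).continuousOn isCompact_Icc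
  · simpa using hquad (Polynomial.X ^ m) (by simpa using hm)
end

section
/- Let n ≥ 1. The following are equivalent: (i) there exist N = n(n+1)/2 distinct points x⁽¹⁾,…,x⁽ᴺ⁾ ∈ ℝ² and real numbers λ_1,…,λ_N such that ∫ f dμ = Σ_{k=1}^{N} λ_k f(x⁽ᵏ⁾) for every f ∈ Π²_{2n-1} (a Gauss cubature rule of degree 2n−1); (ii) the set Z_n = {x ∈ ℝ² : p(x) = 0 for every p ∈ Π²_n satisfying ∫ p·q dμ = 0 for all q ∈ Π²_{n-1}} consists of exactly n(n+1)/2 points. -/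
open MeasureTheory Set

/-- The common zero set of all orthogonal polynomials of degree `n` with respect to `μ`:
points at which every polynomial of total degree ≤ n that is orthogonal to `Π²_{n-1}`
vanishes. -/
def commonZeroSet (μ : Measure (ℝ × ℝ)) (n : ℕ) : Set (ℝ × ℝ) :=
  {z | ∀ P : MvPolynomial (Fin 2) ℝ, P.totalDegree ≤ n →
    (∀ q : MvPolynomial (Fin 2) ℝ, q.totalDegree ≤ n - 1 →
      (∫ y, MvPolynomial.eval ![y.1, y.2] P * MvPolynomial.eval ![y.1, y.2] q ∂μ) = 0) →
    MvPolynomial.eval ![z.1, z.2] P = 0}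

namespace GaussCubature

open MvPolynomial Module

variable {σ : Type*}

/-- `P` has degree at most `n` and is orthogonal to all polynomials of degree at most `n - 1`
with respect to the moment functional `L`. -/
def IsOrthogonal (L : MvPolynomial σ ℝ →ₗ[ℝ] ℝ) (n : ℕ) (P : MvPolynomial σ ℝ) : Prop :=
  P.totalDegree ≤ n ∧ ∀ q : MvPolynomial σ ℝ, q.totalDegree ≤ n - 1 → L (P * q) = 0

/-- The common zeros of the orthogonal polynomials of degree `n`. -/
def commonZeros (L : MvPolynomial σ ℝ →ₗ[ℝ] ℝ) (n : ℕ) : Set (σ → ℝ) :=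
  {z | ∀ P, IsOrthogonal L n P → eval z P = 0}

/-- Evaluation at a point, as a linear functional. -/
noncomputable def evalFunctional (z : σ → ℝ) : MvPolynomial σ ℝ →ₗ[ℝ] ℝ :=
  (aeval z).toLinearMap

@[simp] lemma evalFunctional_apply (z : σ → ℝ) (p : MvPolynomial σ ℝ) :
    evalFunctional z p = eval z p := by
  simp [evalFunctional]

section

variable [Finite σ] (L : MvPolynomial σ ℝ →ₗ[ℝ] ℝ) (hL : ∀ p, p ≠ 0 → 0 < L (p ^ 2))
include hL

lemma exists_representer (m : ℕ) (φ : MvPolynomial σ ℝ →ₗ[ℝ] ℝ) :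
    ∃ r : MvPolynomial σ ℝ, r.totalDegree ≤ m ∧
      ∀ q : MvPolynomial σ ℝ, q.totalDegree ≤ m → L (r * q) = φ q := by
  let V := restrictTotalDegree σ ℝ m
  let B : V →ₗ[ℝ] Dual ℝ V :=
    ((LinearMap.mul ℝ (MvPolynomial σ ℝ)).compr₂ L).domRestrict₁₂ V V
  have hB : Function.Injective B := by
    rw [injective_iff_map_eq_zero]
    intro p hp
    by_contra hne
    have h1 : B p p = 0 := by rw [hp]; rfl
    have h2 := hL p.1 (fun h => hne (Subtype.ext h))
    rw [pow_two] at h2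
    exact h2.ne' h1
  have hs : Function.Surjective B :=
    (LinearMap.injective_iff_surjective_of_finrank_eq_finrank
      (Subspace.dual_finrank_eq (K := ℝ) (V := V)).symm).1 hB
  obtain ⟨r, hr⟩ := hs (φ.domRestrict V)
  refine ⟨r.1, (mem_restrictTotalDegree _ _ _).1 r.2, fun q hq => ?_⟩
  exact LinearMap.congr_fun hr ⟨q, (mem_restrictTotalDegree _ _ _).2 hq⟩

lemma exists_isOrthogonal_sub {n : ℕ} (p : MvPolynomial σ ℝ) (hp : p.totalDegree ≤ n) :
    ∃ r : MvPolynomial σ ℝ, r.totalDegree ≤ n - 1 ∧ IsOrthogonal L n (p - r) := by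
  obtain ⟨r, hr, h⟩ := exists_representer L hL (n - 1) (L ∘ₗ LinearMap.mulLeft ℝ p)
  refine ⟨r, hr, (totalDegree_sub _ _).trans (max_le hp (hr.trans (n.sub_le 1))), fun q hq => ?_⟩
  rw [sub_mul, map_sub, h q hq]
  simp

/-- Every polynomial reduces modulo the orthogonal polynomials of degree `n` to a polynomial
of degree less than `n`. -/
lemma mem_of_isOrthogonal_mul_mem {n : ℕ} (hn : 1 ≤ n) (W : Submodule ℝ (MvPolynomial σ ℝ))
    (hlow : ∀ p : MvPolynomial σ ℝ, p.totalDegree ≤ n - 1 → p ∈ W) (m : ℕ)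
    (hmul : ∀ P q : MvPolynomial σ ℝ, IsOrthogonal L n P → n + q.totalDegree ≤ m → P * q ∈ W)
    (p : MvPolynomial σ ℝ) (hp : p.totalDegree ≤ m) : p ∈ W := by
  induction m generalizing p with
  | zero => exact hlow p (by omega)
  | succ m ih =>
    have ih' := ih fun P q hP hq => hmul P q hP (by omega)
    rw [p.as_sum]
    refine W.sum_mem fun s hs => ?_
    have hsm : s.degree ≤ m + 1 := (le_totalDegree hs).trans hp
    have hdeg (t : σ →₀ ℕ) (c : ℝ) : (monomial t c).totalDegree ≤ t.degree :=
      totalDegree_monomial_le t c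
    obtain hsn | hsn := lt_or_ge s.degree n
    · exact hlow _ ((hdeg _ _).trans (by omega))
    · obtain ⟨t, hts, ht⟩ := s.exists_le_degree_eq n hsn
      obtain ⟨u, rfl⟩ := exists_add_of_le hts
      rw [map_add] at hsm
      obtain ⟨r, hr, hP⟩ := exists_isOrthogonal_sub L hL (n := n) (monomial t (1 : ℝ))
        ((hdeg _ _).trans ht.le)
      set c := coeff (t + u) p
      have hu := hdeg u c
      have key : monomial (t + u) c = (monomial t (1 : ℝ) - r) * monomial u c
          + r * monomial u c := by
        rw [sub_mul, sub_add_cancel, monomial_mul, one_mul]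
      rw [key]
      exact W.add_mem (hmul _ _ hP (by omega))
        (ih' _ ((totalDegree_mul _ _).trans (by omega)))

omit hL [Finite σ] in
lemma linearIndependent_evalFunctional :
    LinearIndependent ℝ (evalFunctional : (σ → ℝ) → MvPolynomial σ ℝ →ₗ[ℝ] ℝ) := by
  have h := (linearIndependent_monoidHom (MvPolynomial σ ℝ) ℝ).comp
    (fun z : σ → ℝ => ((eval z : MvPolynomial σ ℝ →+* ℝ) : MvPolynomial σ ℝ →* ℝ))
    (fun z w hzw => funext fun i => by simpa using DFunLike.congr_fun hzw (X i))
  let F : (MvPolynomial σ ℝ →ₗ[ℝ] ℝ) →ₗ[ℝ] (MvPolynomial σ ℝ → ℝ) :=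
    { toFun := fun f => f, map_add' := fun _ _ => rfl, map_smul' := fun _ _ => rfl }
  refine LinearIndependent.of_comp F ?_
  have hF : (F ∘ evalFunctional : (σ → ℝ) → MvPolynomial σ ℝ → ℝ) = fun z p => eval z p := by
    ext z p
    exact evalFunctional_apply z p
  rw [hF]
  exact h

omit hL [Finite σ] in
lemma apply_mul_eq_zero_of_mem_span {n : ℕ} {φ : MvPolynomial σ ℝ →ₗ[ℝ] ℝ}
    (hφ : φ ∈ Submodule.span ℝ (range fun z : commonZeros L n => evalFunctional z.1))
    {P : MvPolynomial σ ℝ} (hP : IsOrthogonal L n P) (q : MvPolynomial σ ℝ) : φ (P * q) = 0 := by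
  induction hφ using Submodule.span_induction with
  | mem _ h =>
    obtain ⟨z, rfl⟩ := h
    simp [z.2 P hP]
  | zero => rfl
  | add _ _ _ _ h₁ h₂ => rw [LinearMap.add_apply, h₁, h₂, add_zero]
  | smul c _ _ h => rw [LinearMap.smul_apply, h, smul_zero]

lemma linearIndependent_evalFunctional_commonZeros {n : ℕ} (hn : 1 ≤ n) :
    LinearIndependent ℝ (fun z : commonZeros L n =>
      (evalFunctional z.1).domRestrict (restrictTotalDegree σ ℝ (n - 1))) := by
  have h := (linearIndependent_evalFunctional (σ := σ)).comp
    (Subtype.val : commonZeros L n → σ → ℝ) Subtype.val_injective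
  let R : (MvPolynomial σ ℝ →ₗ[ℝ] ℝ) →ₗ[ℝ] (restrictTotalDegree σ ℝ (n - 1) →ₗ[ℝ] ℝ) :=
    LinearMap.lcomp ℝ ℝ (restrictTotalDegree σ ℝ (n - 1)).subtype
  refine h.map (f := R) ?_
  rw [Submodule.disjoint_def]
  intro φ hφ hker
  refine LinearMap.ext fun p => ?_
  refine mem_of_isOrthogonal_mul_mem L hL hn (LinearMap.ker φ) (fun q hq => ?_) p.totalDegree
    (fun P q hP _ => apply_mul_eq_zero_of_mem_span L hφ hP q) p le_rfl
  exact LinearMap.congr_fun hker ⟨q, (mem_restrictTotalDegree _ _ _).2 hq⟩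

/-- The nodes of a Gauss cubature rule are exactly the common zeros. -/
lemma commonZeros_eq_range {ι : Type*} [Fintype ι] {n : ℕ} (hn : 1 ≤ n)
    (hι : finrank ℝ (restrictTotalDegree σ ℝ (n - 1)) = Fintype.card ι)
    (x : ι → σ → ℝ) (lam : ι → ℝ) (hx : Function.Injective x)
    (hcub : ∀ f : MvPolynomial σ ℝ, f.totalDegree ≤ 2 * n - 1 →
      L f = ∑ k, lam k * eval (x k) f) :
    commonZeros L n = range x := by
  classical
  let E : restrictTotalDegree σ ℝ (n - 1) →ₗ[ℝ] ι → ℝ :=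
    (LinearMap.pi fun k => evalFunctional (x k)).domRestrict _
  have hE : Function.Injective E := by
    rw [injective_iff_map_eq_zero]
    intro p hp
    by_contra hne
    have hdeg := (mem_restrictTotalDegree _ _ _).1 p.2
    have h0 (k : ι) : eval (x k) p.1 = 0 := by simpa [E] using congrFun hp k
    refine (hL p.1 fun h => hne (Subtype.ext h)).ne' ?_
    rw [hcub _ ((totalDegree_pow _ _).trans (by omega))]
    simp [h0]
  have hs : Function.Surjective E :=
    (LinearMap.injective_iff_surjective_of_finrank_eq_finrank (by simpa using hι)).1 hE
  have hsub : range x ⊆ commonZeros L n := by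
    rintro _ ⟨k, rfl⟩ P hP
    obtain ⟨q, hq⟩ := hs (Pi.single k 1)
    have hdeg := (mem_restrictTotalDegree _ _ _).1 q.2
    have hqx (j : ι) : eval (x j) q.1 = (Pi.single k 1 : ι → ℝ) j := by
      simpa [E] using congrFun hq j
    have hlam : L (q.1 ^ 2) = lam k := by
      rw [hcub _ ((totalDegree_pow _ _).trans (by omega))]
      simp [hqx, Pi.single_apply]
    have hlam0 : lam k ≠ 0 := by
      rw [← hlam]
      refine (hL _ fun h => ?_).ne'
      simpa [h] using hqx k
    have hPq := hP.2 q.1 hdeg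
    have hP1 := hP.1
    rw [hcub _ ((totalDegree_mul _ _).trans (by omega))] at hPq
    simpa [hqx, Pi.single_apply, hlam0] using hPq
  have hli := linearIndependent_evalFunctional_commonZeros L hL hn
  have hfin : (commonZeros L n).Finite := hli.finite
  have := hfin.fintype
  refine (Set.eq_of_subset_of_ncard_le hsub ?_ hfin).symm
  rw [← image_univ, ncard_image_of_injective _ hx, ncard_univ, Nat.card_eq_fintype_card, ← hι,
    ← Subspace.dual_finrank_eq, ← Nat.card_coe_set_eq, Nat.card_eq_fintype_card]
  exact hli.fintype_card_le_finrank

/-- If there are as many common zeros as possible, they are the nodes of a Gauss cubature rule. -/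
lemma exists_cubature {ι : Type*} [Fintype ι] {n : ℕ} (hn : 1 ≤ n)
    (hι : finrank ℝ (restrictTotalDegree σ ℝ (n - 1)) = Fintype.card ι)
    (e : ι ≃ commonZeros L n) :
    ∃ lam : ι → ℝ, ∀ f : MvPolynomial σ ℝ, f.totalDegree ≤ 2 * n - 1 →
      L f = ∑ k, lam k * eval (e k).1 f := by
  have hli := (linearIndependent_evalFunctional_commonZeros L hL hn).comp e e.injective
  have htop := hli.span_eq_top_of_card_eq_finrank' (by
    rw [← hι]
    exact (Subspace.dual_finrank_eq (K := ℝ)).symm)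
  obtain ⟨lam, hlam⟩ := (Submodule.mem_span_range_iff_exists_fun ℝ).1
    (htop ▸ Submodule.mem_top : L.domRestrict (restrictTotalDegree σ ℝ (n - 1)) ∈ _)
  refine ⟨lam, fun f hf => ?_⟩
  have hker := mem_of_isOrthogonal_mul_mem L hL hn
    (LinearMap.ker (L - ∑ k, lam k • evalFunctional (e k).1)) (fun q hq => ?_) (2 * n - 1)
    (fun P q hP hq => ?_) f hf
  · simpa [sub_eq_zero] using hker
  · have h := LinearMap.congr_fun hlam ⟨q, (mem_restrictTotalDegree _ _ _).2 hq⟩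
    simp at h
    simp [h]
  · have h (k : ι) : eval (e k).1 P = 0 := (e k).2 P hP
    simp [h, hP.2 q (by omega)]

end

lemma finrank_restrictTotalDegree_fin_two {n : ℕ} (hn : 1 ≤ n) :
    finrank ℝ (restrictTotalDegree (Fin 2) ℝ (n - 1)) = n * (n + 1) / 2 := by
  let e : {s : Fin 2 →₀ ℕ | (s.sum fun _ e => e) ≤ n - 1} ≃ Σ k : Fin n, Fin (k + 1) :=
    { toFun := fun s => ⟨⟨s.1 0 + s.1 1, by
          have := s.2
          simp [Finsupp.sum_fintype] at this
          omega⟩, ⟨s.1 0, by simp⟩⟩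
      invFun := fun k => ⟨Finsupp.equivFunOnFinite.symm ![k.2, k.1 - k.2], by
          have := k.1.2
          have := k.2.2
          simp [Finsupp.sum_fintype]
          omega⟩
      left_inv := fun s => by
        ext i
        fin_cases i <;> simp
      right_inv := fun ⟨⟨k, hk⟩, ⟨j, hj⟩⟩ => by
        have : j + (k - j) = k := by simp at hj; omega
        simpa using ⟨Fin.ext this, (Fin.heq_ext_iff (congrArg (· + 1) this)).2 rfl⟩ }
  rw [restrictTotalDegree, finrank_eq_nat_card_basis (basisRestrictSupport ℝ _), Nat.card_congr e,
    Nat.card_eq_fintype_card, Fintype.card_sigma]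
  simp only [Fintype.card_fin]
  rw [Fin.sum_univ_eq_sum_range (fun k => k + 1) n]
  have h := Finset.sum_range_id_mul_two (n + 1)
  rw [Finset.sum_range_succ'] at h
  simp at h
  rw [mul_comm n]
  omega

lemma integrable_of_continuous {X : Type*} [TopologicalSpace X] [T2Space X] [MeasurableSpace X]
    [OpensMeasurableSpace X]
    (μ : Measure X) [IsFiniteMeasure μ] (hcomp : ∃ K : Set X, IsCompact K ∧ μ Kᶜ = 0)
    {f : X → ℝ} (hf : Continuous f) : Integrable f μ := by
  obtain ⟨K, hK, hμ⟩ := hcomp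
  have hr : μ.restrict K = μ := Measure.restrict_eq_self_of_ae_mem (by simpa [mem_ae_iff] using hμ)
  have := hf.continuousOn.integrableOn_compact (μ := μ) hK
  rwa [IntegrableOn, hr] at this

end GaussCubature

theorem stmt5 (μ : Measure (ℝ × ℝ)) [IsFiniteMeasure μ]
    (hcomp : ∃ K : Set (ℝ × ℝ), IsCompact K ∧ μ Kᶜ = 0)
    (hpos : ∀ P : MvPolynomial (Fin 2) ℝ, P ≠ 0 →
      0 < ∫ z, (MvPolynomial.eval ![z.1, z.2] P) ^ 2 ∂μ)
    (n : ℕ) (hn : 1 ≤ n) :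
    -- (i) a Gauss cubature rule of degree 2n−1 with n(n+1)/2 nodes exists
    (∃ (x : Fin (n * (n+1) / 2) → ℝ × ℝ) (lam : Fin (n * (n+1) / 2) → ℝ),
      Function.Injective x ∧
      ∀ f : MvPolynomial (Fin 2) ℝ, f.totalDegree ≤ 2*n - 1 →
        (∫ z, MvPolynomial.eval ![z.1, z.2] f ∂μ) =
          ∑ k, lam k * MvPolynomial.eval ![(x k).1, (x k).2] f) ↔
    -- (ii) the common zero set of orthogonal polynomials of degree n has n(n+1)/2 points
    ((commonZeroSet μ n).Finite ∧ (commonZeroSet μ n).ncard = n * (n+1) / 2) := by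
  obtain ⟨L, hLdef⟩ : ∃ L : MvPolynomial (Fin 2) ℝ →ₗ[ℝ] ℝ,
      ∀ f, L f = ∫ z, MvPolynomial.eval ![z.1, z.2] f ∂μ := by
    have hint (f : MvPolynomial (Fin 2) ℝ) :
        Integrable (fun z : ℝ × ℝ => MvPolynomial.eval ![z.1, z.2] f) μ :=
      GaussCubature.integrable_of_continuous μ hcomp <| f.continuous_eval.comp <|
        continuous_pi fun i => by fin_cases i <;> simp <;> fun_prop
    exact ⟨{ toFun := fun f => ∫ z, MvPolynomial.eval ![z.1, z.2] f ∂μ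
             map_add' := fun f g => by simp [integral_add (hint f) (hint g)]
             map_smul' := fun c f => by simp [integral_const_mul] }, fun _ => rfl⟩
  have hL (p : MvPolynomial (Fin 2) ℝ) (hp : p ≠ 0) : 0 < L (p ^ 2) := by
    simpa [hLdef] using hpos p hp
  let e : ℝ × ℝ ≃ (Fin 2 → ℝ) := (finTwoArrowEquiv ℝ).symm
  have he (z : ℝ × ℝ) : ![z.1, z.2] = e z := rfl
  have hZ : commonZeroSet μ n = e ⁻¹' GaussCubature.commonZeros L n := by
    ext z
    simp [commonZeroSet, GaussCubature.commonZeros, GaussCubature.IsOrthogonal, hLdef, he]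
  have hdim := (GaussCubature.finrank_restrictTotalDegree_fin_two hn).trans
    (Fintype.card_fin _).symm
  constructor
  · rintro ⟨x, lam, hx, hcub⟩
    have hr := GaussCubature.commonZeros_eq_range L hL hn hdim (e ∘ x) lam
      (e.injective.comp hx) (fun f hf => (hLdef f).trans (hcub f hf))
    have hr' : commonZeroSet μ n = range x := by
      rw [hZ, hr, range_comp, e.injective.preimage_image]
    rw [hr']
    refine ⟨finite_range x, ?_⟩
    rw [← image_univ, ncard_image_of_injective _ hx, ncard_univ, Nat.card_fin]
  · rintro ⟨hfin, hcard⟩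
    have := hfin.to_subtype
    let g : Fin (n * (n + 1) / 2) ≃ commonZeroSet μ n :=
      (Finite.equivFinOfCardEq (by rw [Nat.card_coe_set_eq, hcard])).symm
    let e' : commonZeroSet μ n ≃ GaussCubature.commonZeros L n :=
      (Equiv.setCongr hZ).trans (e.subtypeEquiv fun _ => Iff.rfl)
    obtain ⟨lam, hlam⟩ := GaussCubature.exists_cubature L hL hn hdim (g.trans e')
    exact ⟨fun k => (g k).1, lam, Subtype.val_injective.comp g.injective,
      fun f hf => (hLdef f).symm.trans (hlam f hf)⟩
end

section
/- (Möller's lower bound.) Let n ≥ 1. Suppose x⁽¹⁾,…,x⁽ᴺ⁾ are distinct points of ℝ² and λ_1,…,λ_N are positive real numbers such that ∫ f dμ = Σ_{k=1}^{N} λ_k f(x⁽ᵏ⁾) for every f ∈ Π²_{2n-1}. Then N ≥ n(n+1)/2 + ⌊n/2⌋. -/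
open MeasureTheory Set

namespace Moller

open MvPolynomial Module

/-- The bivariate real polynomials of total degree less than `m`. -/
noncomputable abbrev polyDegLT (m : ℕ) : Submodule ℝ (MvPolynomial (Fin 2) ℝ) :=
  restrictSupport ℝ {a | a.degree < m}

/-- The substitution `p(z) ↦ p(-z)`. -/
noncomputable def reflect : MvPolynomial (Fin 2) ℝ →ₐ[ℝ] MvPolynomial (Fin 2) ℝ :=
  aeval fun i => -X i

lemma mem_polyDegLT {m : ℕ} {p : MvPolynomial (Fin 2) ℝ} :
    p ∈ polyDegLT m ↔ ∀ a : Fin 2 →₀ ℕ, m ≤ a.degree → coeff a p = 0 := by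
  rw [mem_restrictSupport_iff]
  constructor
  · intro h a ha
    by_contra hc
    have := h (Finset.mem_coe.2 (mem_support_iff.2 hc))
    simp only [mem_ofPred_eq] at this
    omega
  · intro h a ha
    by_contra hc
    simp only [mem_ofPred_eq, not_lt] at hc
    exact mem_support_iff.1 (Finset.mem_coe.1 ha) (h a hc)

lemma polyDegLT_mono {m k : ℕ} (h : m ≤ k) : polyDegLT m ≤ polyDegLT k :=
  restrictSupport_mono _ fun _ ha => lt_of_lt_of_le ha h

lemma totalDegree_lt_of_mem {m : ℕ} (hm : 1 ≤ m) {p : MvPolynomial (Fin 2) ℝ}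
    (hp : p ∈ polyDegLT m) : p.totalDegree < m := by
  rw [totalDegree_eq, Finset.sup_lt_iff (bot_lt_iff_ne_bot.2 (Nat.one_le_iff_ne_zero.1 hm))]
  intro a ha
  have : a.degree < m := hp (Finset.mem_coe.2 ha)
  rwa [Finsupp.card_toMultiset]

lemma X_mul_mem {m : ℕ} (i : Fin 2) {p : MvPolynomial (Fin 2) ℝ} :
    X i * p ∈ polyDegLT (m + 1) ↔ p ∈ polyDegLT m := by
  simp only [mem_polyDegLT]
  constructor
  · intro h a ha
    rw [← coeff_X_mul a i p]
    apply h
    simp only [map_add, Finsupp.degree_single]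
    omega
  · intro h a ha
    classical
    rw [coeff_X_mul']
    split_ifs with hi
    · apply h
      have h1 : Finsupp.single i 1 ≤ a := by
        rw [Finsupp.single_le_iff]
        exact Nat.one_le_iff_ne_zero.2 (Finsupp.mem_support_iff.1 hi)
      have h2 := congrArg Finsupp.degree (tsub_add_cancel_of_le h1)
      simp only [map_add, Finsupp.degree_single] at h2
      omega
    · rfl

lemma coeff_reflect (a : Fin 2 →₀ ℕ) (p : MvPolynomial (Fin 2) ℝ) :
    coeff a (reflect p) = (-1) ^ a.degree * coeff a p := by
  classical
  induction p using MvPolynomial.induction_on' with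
  | monomial b c =>
    have : reflect (monomial b c) = monomial b ((-1) ^ b.degree * c) := by
      rw [reflect, aeval_monomial, monomial_eq, Finsupp.prod_fintype _ _ (by simp),
        Finsupp.prod_fintype _ _ (by simp), Finsupp.degree_eq_sum]
      simp only [Fin.prod_univ_two, Fin.sum_univ_two, algebraMap_eq, C_mul, C_pow, C_neg, C_1,
        neg_pow (X _ : MvPolynomial (Fin 2) ℝ), pow_add]
      ring
    rw [this, coeff_monomial, coeff_monomial]
    split_ifs with h
    · rw [h]
    · simp
  | add p q hp hq => rw [map_add, coeff_add, coeff_add, hp, hq, mul_add]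

lemma reflect_mem {m : ℕ} {p : MvPolynomial (Fin 2) ℝ} (hp : p ∈ polyDegLT m) :
    reflect p ∈ polyDegLT m := by
  rw [mem_polyDegLT] at *
  intro a ha
  rw [coeff_reflect, hp a ha, mul_zero]

lemma reflect_reflect (p : MvPolynomial (Fin 2) ℝ) : reflect (reflect p) = p := by
  ext a
  rw [coeff_reflect, coeff_reflect, ← mul_assoc, ← mul_pow]
  simp

lemma reflect_X_mul (i : Fin 2) (p : MvPolynomial (Fin 2) ℝ) :
    reflect (X i * p) = -(X i * reflect p) := by
  simp [reflect]

lemma card_degree_lt (m : ℕ) :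
    Nat.card {a : Fin 2 →₀ ℕ // a.degree < m} = m * (m + 1) / 2 := by
  let e : {a : Fin 2 →₀ ℕ // a.degree < m} ≃
      ((Finset.range m).sigma fun k => Finset.range (k + 1)) :=
    { toFun := fun a => ⟨⟨a.1.degree, a.1 0⟩, by
        have := a.2
        have h := Finsupp.degree_eq_sum a.1
        simp only [Fin.sum_univ_two] at h
        simp only [Finset.mem_sigma, Finset.mem_range]
        omega⟩
      invFun := fun b => ⟨Finsupp.equivFunOnFinite.symm ![b.1.2, b.1.1 - b.1.2], by
        have := b.2
        simp only [Finset.mem_sigma, Finset.mem_range] at this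
        rw [Finsupp.degree_eq_sum]
        simp only [Fin.sum_univ_two, Finsupp.coe_equivFunOnFinite_symm, Matrix.cons_val_zero,
          Matrix.cons_val_one]
        omega⟩
      left_inv := by
        rintro ⟨a, ha⟩
        have h := Finsupp.degree_eq_sum a
        simp only [Fin.sum_univ_two] at h
        ext i
        fin_cases i <;> simp [h]
      right_inv := by
        rintro ⟨⟨k, i⟩, hb⟩
        simp only [Finset.mem_sigma, Finset.mem_range] at hb
        apply Subtype.ext
        simp only [Finsupp.degree_eq_sum, Fin.sum_univ_two, Finsupp.coe_equivFunOnFinite_symm,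
          Matrix.cons_val_zero, Matrix.cons_val_one]
        congr 1
        omega }
  rw [Nat.card_congr e, Nat.card_eq_fintype_card, Fintype.card_coe, Finset.card_sigma]
  simp only [Finset.card_range]
  rw [← Finset.sum_range_succ' (fun k => k) m |>.trans (add_zero _), Finset.sum_range_id]
  simp [mul_comm]

lemma finite_degree_lt (m : ℕ) : Finite {a : Fin 2 →₀ ℕ // a.degree < m} :=
  (Finsupp.finite_of_degree_lt m).to_subtype

instance (m : ℕ) : FiniteDimensional ℝ (polyDegLT m) :=
  haveI : Finite ({a | a.degree < m} : Set (Fin 2 →₀ ℕ)) := finite_degree_lt m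
  (basisRestrictSupport ℝ _).finiteDimensional_of_finite

lemma finrank_polyDegLT (m : ℕ) : finrank ℝ (polyDegLT m) = m * (m + 1) / 2 := by
  rw [finrank_eq_nat_card_basis (basisRestrictSupport ℝ _)]
  exact card_degree_lt m

/-- If `r` is orthogonal to all `X i * g` with `deg g < n`, then on polynomials of degree less
than `n` pairing with `r` only sees the constant coefficient. -/
lemma apply_mul_eq_coeff_zero (L : MvPolynomial (Fin 2) ℝ →ₗ[ℝ] ℝ) {n : ℕ}
    {r : MvPolynomial (Fin 2) ℝ} (hr : ∀ i, ∀ g ∈ polyDegLT n, L (r * (X i * g)) = 0)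
    {f : MvPolynomial (Fin 2) ℝ} (hf : f ∈ polyDegLT n) :
    L (r * f) = coeff 0 f * L r := by
  have key : ∀ a : Fin 2 →₀ ℕ, a.degree < n → ∀ c : ℝ,
      L (r * monomial a c) = coeff 0 (monomial a c) * L r := by
    intro a ha c
    classical
    by_cases h0 : a = 0
    · subst h0
      rw [coeff_monomial, if_pos rfl, ← C_apply, mul_comm, C_mul', map_smul, smul_eq_mul]
    · obtain ⟨i, hi⟩ := Finsupp.ne_iff.1 h0
      have h1 : Finsupp.single i 1 ≤ a := by
        rw [Finsupp.single_le_iff]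
        exact Nat.one_le_iff_ne_zero.2 hi
      have h2 : monomial a c = X i * monomial (a - Finsupp.single i 1) c := by
        rw [X, monomial_mul, one_mul, add_tsub_cancel_of_le h1]
      have h3 := congrArg Finsupp.degree (tsub_add_cancel_of_le h1)
      simp only [map_add, Finsupp.degree_single] at h3
      rw [coeff_monomial, if_neg h0, zero_mul, h2]
      apply hr
      rw [monomial_mem_restrictSupport]
      left
      simp only [mem_ofPred_eq]
      omega
  conv_lhs => rw [f.as_sum]
  conv_rhs => rw [f.as_sum]
  rw [Finset.mul_sum, map_sum, coeff_sum, Finset.sum_mul]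
  exact Finset.sum_congr rfl fun a ha => key a (hf (Finset.mem_coe.2 ha)) _

section Cubature

variable {A : Type*} [CommRing A] [Algebra ℝ A]
  {L : MvPolynomial (Fin 2) ℝ →ₗ[ℝ] ℝ} {E : MvPolynomial (Fin 2) ℝ →ₐ[ℝ] A} {n : ℕ}

lemma eq_zero_of_orthogonal (hpos : ∀ p, p ≠ 0 → 0 < L (p * p)) {m : ℕ}
    {p : MvPolynomial (Fin 2) ℝ} (hp : p ∈ polyDegLT m)
    (h : ∀ g ∈ polyDegLT m, L (p * g) = 0) : p = 0 := by
  by_contra hne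
  exact (hpos p hne).ne' (h p hp)

lemma eq_zero_of_eval_eq_zero (hpos : ∀ p, p ≠ 0 → 0 < L (p * p)) (hn : 1 ≤ n)
    (hcub : ∀ f : MvPolynomial (Fin 2) ℝ, f.totalDegree ≤ 2 * n - 1 → E f = 0 → L f = 0)
    {p : MvPolynomial (Fin 2) ℝ} (hp : p ∈ polyDegLT n) (h : E p = 0) : p = 0 := by
  refine eq_zero_of_orthogonal hpos hp fun g hg => hcub _ ?_ (by rw [map_mul, h, zero_mul])
  have h1 := totalDegree_lt_of_mem hn hp
  have h2 := totalDegree_lt_of_mem hn hg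
  have h3 := totalDegree_mul p g
  omega

lemma apply_X_mul_mul_eq (hn : 1 ≤ n)
    (hcub : ∀ f : MvPolynomial (Fin 2) ℝ, f.totalDegree ≤ 2 * n - 1 → E f = 0 → L f = 0)
    {p q g : MvPolynomial (Fin 2) ℝ} {i : Fin 2} (hp : p ∈ polyDegLT n) (hq : q ∈ polyDegLT n)
    (hg : g ∈ polyDegLT n) (h : E (X i * p) = E q) : L (X i * p * g) = L (q * g) := by
  rw [← sub_eq_zero, ← map_sub]
  apply hcub
  · rw [← sub_mul]
    have h1 := totalDegree_lt_of_mem hn hg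
    have h2 : X i * p - q ∈ polyDegLT (n + 1) :=
      sub_mem ((X_mul_mem i).2 hp) (polyDegLT_mono n.le_succ hq)
    have h3 := totalDegree_lt_of_mem (by omega) h2
    have h4 := totalDegree_mul (X i * p - q) g
    omega
  · rw [map_sub, map_mul, map_mul E q, h, sub_self]

/-- An orthogonal polynomial of degree `n - 1` whose multiples by `X 0` and `X 1` agree on the
nodes with polynomials of degree less than `n` differs from some `s` of degree less than `n - 1`
by a polynomial orthogonal to all `X i * g` with `deg g < n`; for even `n` this difference has no
constant coefficient. -/
lemma exists_orthogonal_sub (hpos : ∀ p, p ≠ 0 → 0 < L (p * p))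
    (hsym : ∀ p, L (reflect p) = L p) (hn : 1 ≤ n)
    (hcub : ∀ f : MvPolynomial (Fin 2) ℝ, f.totalDegree ≤ 2 * n - 1 → E f = 0 → L f = 0)
    {p : MvPolynomial (Fin 2) ℝ} (hp : p ∈ polyDegLT n)
    (horth : ∀ g ∈ polyDegLT (n - 1), L (p * g) = 0)
    {q : Fin 2 → MvPolynomial (Fin 2) ℝ} (hq : ∀ i, q i ∈ polyDegLT n)
    (hpq : ∀ i, E (X i * p) = E (q i)) :
    ∃ s ∈ polyDegLT (n - 1), (∀ i, ∀ g ∈ polyDegLT n, L ((p - s) * (X i * g)) = 0) ∧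
      (Even n → coeff 0 (p - s) = 0) := by
  have hsym' : ∀ f g, L (reflect f * g) = L (f * reflect g) := fun f g => by
    rw [← hsym (f * reflect g), map_mul reflect, reflect_reflect]
  set ε : ℝ := (-1) ^ (n - 1) with hε
  have hεε : ε * ε = 1 := by rw [hε, ← mul_pow]; simp
  have hrefl : reflect p = ε • p := by
    rw [← sub_eq_zero]
    apply eq_zero_of_orthogonal hpos (m := n - 1)
    · rw [mem_polyDegLT] at hp ⊢
      intro a ha
      rw [coeff_sub, coeff_smul, coeff_reflect, smul_eq_mul]
      rcases Nat.eq_or_lt_of_le ha with h | h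
      · rw [hε, h, sub_self]
      · rw [hp a (by omega)]; ring
    · intro g hg
      rw [sub_mul, map_sub, hsym', horth _ (reflect_mem hg), smul_mul_assoc, map_smul, horth g hg]
      simp
  have hX : ∀ i, ∀ g ∈ polyDegLT n, L (X i * p * g) = L (q i * g) := fun i g hg =>
    apply_X_mul_mul_eq hn hcub hp (hq i) hg (hpq i)
  have hreflq : ∀ i, reflect (q i) = -(ε • q i) := by
    intro i
    rw [← sub_eq_zero]
    apply eq_zero_of_orthogonal hpos (m := n)
    · exact sub_mem (reflect_mem (hq i)) (neg_mem (Submodule.smul_mem _ _ (hq i)))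
    · intro g hg
      rw [sub_mul, map_sub, hsym', ← hX i _ (reflect_mem hg), ← hsym', reflect_X_mul, hrefl,
        neg_mul, neg_mul, mul_smul_comm, smul_mul_assoc, smul_mul_assoc, map_neg, map_neg,
        map_smul, map_smul, hX i g hg, sub_self]
  have hqlow : ∀ i, q i ∈ polyDegLT (n - 1) := by
    intro i
    rw [mem_polyDegLT]
    intro a ha
    rcases Nat.eq_or_lt_of_le ha with h | h
    · have h1 := congrArg (coeff a) (hreflq i)
      rw [coeff_reflect, coeff_neg, coeff_smul, smul_eq_mul, ← h, ← hε] at h1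
      have h2 : ε ≠ 0 := fun h0 => by simp [h0] at hεε
      have h3 : ε * coeff a (q i) = 0 := by linarith
      exact (mul_eq_zero.1 h3).resolve_left h2
    · exact mem_polyDegLT.1 (hq i) a (by omega)
  have hcomm : X 1 * q 0 = X 0 * q 1 := by
    rw [← sub_eq_zero]
    apply eq_zero_of_eval_eq_zero hpos hn hcub
    · have h1 := (X_mul_mem 1).2 (hqlow 0)
      have h2 := (X_mul_mem 0).2 (hqlow 1)
      rw [Nat.sub_add_cancel hn] at h1 h2
      exact sub_mem h1 h2
    · rw [map_sub, map_mul, map_mul, ← hpq, ← hpq, map_mul, map_mul]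
      ring
  obtain ⟨s, hs⟩ : (X 0 : MvPolynomial (Fin 2) ℝ) ∣ q 0 := by
    have h : (X 0 : MvPolynomial (Fin 2) ℝ) ∣ X 1 * q 0 := ⟨_, hcomm⟩
    rw [X_dvd_mul_iff] at h
    refine h.resolve_left fun h => ?_
    rw [X_dvd_X] at h
    simp at h
  have hs1 : q 1 = X 1 * s := by
    rw [hs] at hcomm
    apply mul_left_cancel₀ (X_ne_zero (R := ℝ) (0 : Fin 2))
    rw [← hcomm]
    ring
  have hqs : ∀ i, q i = X i * s := by
    intro i
    fin_cases i
    · exact hs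
    · exact hs1
  have hsmem : s ∈ polyDegLT (n - 1) := by
    have h := polyDegLT_mono (show n - 1 ≤ (n - 1) + 1 by omega) (hqlow 0)
    rwa [hs, X_mul_mem] at h
  refine ⟨s, hsmem, fun i g hg => ?_, fun heven => ?_⟩
  · have h := hX i g hg
    rw [hqs i] at h
    rw [sub_mul, map_sub, sub_eq_zero, mul_left_comm, ← mul_assoc, h]
    congr 1
    ring
  · have hε1 : ε = -1 := Odd.neg_one_pow (Nat.Even.sub_odd hn heven odd_one)
    have h1 := congrArg (coeff 0) hrefl
    have h2 := congrArg (coeff (Finsupp.single 0 1 + 0)) (hreflq 0)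
    rw [coeff_reflect, coeff_neg, coeff_smul, hs, coeff_X_mul, hε1] at h2
    rw [coeff_reflect, coeff_smul, hε1] at h1
    simp at h1 h2
    rw [coeff_sub]
    linarith

/-- Two polynomials as in `exists_orthogonal_sub` are proportional. -/
lemma smul_eq_smul_of_orthogonal (hpos : ∀ p, p ≠ 0 → 0 < L (p * p))
    {p p' s s' : MvPolynomial (Fin 2) ℝ} (hp : p ∈ polyDegLT n) (hp' : p' ∈ polyDegLT n)
    (horth : ∀ g ∈ polyDegLT (n - 1), L (p * g) = 0)
    (horth' : ∀ g ∈ polyDegLT (n - 1), L (p' * g) = 0)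
    (hs : s ∈ polyDegLT (n - 1)) (hs' : s' ∈ polyDegLT (n - 1))
    (hr : ∀ i, ∀ g ∈ polyDegLT n, L ((p - s) * (X i * g)) = 0)
    (hr' : ∀ i, ∀ g ∈ polyDegLT n, L ((p' - s') * (X i * g)) = 0)
    {c c' : ℝ} (hc : c * coeff 0 (p - s) = c' * coeff 0 (p' - s')) :
    c • p = c' • p' := by
  have hmono := polyDegLT_mono (Nat.sub_le n 1)
  have hw : c • (p - s) - c' • (p' - s') = 0 := by
    have hmem : c • (p - s) - c' • (p' - s') ∈ polyDegLT n :=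
      sub_mem (Submodule.smul_mem _ _ (sub_mem hp (hmono hs)))
        (Submodule.smul_mem _ _ (sub_mem hp' (hmono hs')))
    by_contra hne
    apply (hpos _ hne).ne'
    rw [apply_mul_eq_coeff_zero L (n := n) _ hmem]
    · rw [coeff_sub, coeff_smul, coeff_smul, smul_eq_mul, smul_eq_mul, hc, sub_self, zero_mul]
    · intro i g hg
      rw [sub_mul, smul_mul_assoc, smul_mul_assoc, map_sub, map_smul, map_smul, hr i g hg,
        hr' i g hg]
      simp
  rw [← sub_eq_zero]
  have heq : c • p - c' • p' = c • s - c' • s' := by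
    rw [← sub_eq_zero, ← hw]
    module
  apply eq_zero_of_orthogonal hpos (m := n - 1)
  · rw [heq]
    exact sub_mem (Submodule.smul_mem _ _ hs) (Submodule.smul_mem _ _ hs')
  · intro g hg
    rw [sub_mul, smul_mul_assoc, smul_mul_assoc, map_sub, map_smul, map_smul, horth g hg,
      horth' g hg]
    simp

/-- Möller's lower bound for a symmetric positive functional `L` that, up to degree `2 * n - 1`,
factors through an algebra homomorphism into a finite-dimensional algebra. -/
theorem le_finrank [FiniteDimensional ℝ A] (hpos : ∀ p, p ≠ 0 → 0 < L (p * p))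
    (hsym : ∀ p, L (reflect p) = L p) (hn : 1 ≤ n)
    (hcub : ∀ f : MvPolynomial (Fin 2) ℝ, f.totalDegree ≤ 2 * n - 1 → E f = 0 → L f = 0) :
    n * (n + 1) / 2 + n / 2 ≤ finrank ℝ A := by
  let H : Submodule ℝ A := LinearMap.range (E.toLinearMap.domRestrict (polyDegLT n))
  let pairing : polyDegLT n →ₗ[ℝ] Dual ℝ (polyDegLT (n - 1)) :=
    ((LinearMap.mul ℝ (MvPolynomial (Fin 2) ℝ)).compr₂ L).domRestrict₁₂ _ _
  let shift (i : Fin 2) : polyDegLT n →ₗ[ℝ] A ⧸ H :=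
    H.mkQ ∘ₗ E.toLinearMap ∘ₗ LinearMap.mulLeft ℝ (X i) ∘ₗ (polyDegLT n).subtype
  let Φ := pairing.prod ((shift 0).prod (shift 1))
  have hH : finrank ℝ H = n * (n + 1) / 2 := by
    rw [← finrank_polyDegLT]
    refine LinearMap.finrank_range_of_inj ((injective_iff_map_eq_zero _).2 fun p hp => ?_)
    exact Subtype.ext (eq_zero_of_eval_eq_zero hpos hn hcub p.2 hp)
  have hker : ∀ p ∈ LinearMap.ker Φ, ∃ s ∈ polyDegLT (n - 1),
      (∀ g ∈ polyDegLT (n - 1), L (p.1 * g) = 0) ∧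
      (∀ i, ∀ g ∈ polyDegLT n, L ((p.1 - s) * (X i * g)) = 0) ∧
      (Even n → coeff 0 (p.1 - s) = 0) := by
    intro p hp
    have hp1 : pairing p = 0 ∧ shift 0 p = 0 ∧ shift 1 p = 0 := by
      simpa [Φ] using hp
    have horth : ∀ g ∈ polyDegLT (n - 1), L (p.1 * g) = 0 := fun g hg =>
      LinearMap.congr_fun hp1.1 ⟨g, hg⟩
    have hshift : ∀ i, ∃ q ∈ polyDegLT n, E (X i * p.1) = E q := by
      intro i
      have h : shift i p = 0 := by
        fin_cases i
        · exact hp1.2.1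
        · exact hp1.2.2
      obtain ⟨⟨q, hq⟩, hqe⟩ := (Submodule.Quotient.mk_eq_zero H).1 h
      exact ⟨q, hq, hqe.symm⟩
    choose q hq hpq using hshift
    obtain ⟨s, hs, h1, h2⟩ := exists_orthogonal_sub hpos hsym hn hcub p.2 horth hq hpq
    exact ⟨s, hs, horth, h1, h2⟩
  have hrank := LinearMap.finrank_range_add_finrank_ker Φ
  have hrange := Submodule.finrank_le (LinearMap.range Φ)
  have hquot := H.finrank_quotient_add_finrank
  rw [finrank_prod, finrank_prod, Subspace.dual_finrank_eq, finrank_polyDegLT] at hrange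
  rw [finrank_polyDegLT] at hrank
  have hgauss : n * (n + 1) / 2 = (n - 1) * (n - 1 + 1) / 2 + n := by
    obtain ⟨m, rfl⟩ := Nat.exists_eq_add_of_le' hn
    rw [Nat.add_sub_cancel, show (m + 1) * (m + 1 + 1) = m * (m + 1) + (m + 1) * 2 by ring,
      Nat.add_mul_div_right _ _ two_pos]
  have hzero : ∀ p ∈ LinearMap.ker Φ, ∀ s ∈ polyDegLT (n - 1),
      (∀ g ∈ polyDegLT (n - 1), L (p.1 * g) = 0) →
      (∀ i, ∀ g ∈ polyDegLT n, L ((p.1 - s) * (X i * g)) = 0) →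
      coeff 0 (p.1 - s) = 0 → p = 0 := by
    intro p _ s hs ho hr hc
    have h := smul_eq_smul_of_orthogonal hpos p.2 p.2 ho ho hs hs hr hr (c := 1) (c' := 0)
      (by rw [hc, mul_zero, mul_zero])
    apply Subtype.ext
    simpa using h
  have hone : finrank ℝ (LinearMap.ker Φ) ≤ 1 := by
    by_cases hbot : ∃ p₀ ∈ LinearMap.ker Φ, p₀ ≠ 0
    · obtain ⟨p₀, hp₀, hne⟩ := hbot
      obtain ⟨s₀, hs₀, ho₀, hr₀, -⟩ := hker p₀ hp₀
      have hc₀ : coeff 0 (p₀.1 - s₀) ≠ 0 := fun h => hne (hzero p₀ hp₀ s₀ hs₀ ho₀ hr₀ h)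
      refine finrank_le_one ⟨p₀, hp₀⟩ fun ⟨p, hp⟩ => ?_
      obtain ⟨s, hs, ho, hr, -⟩ := hker p hp
      refine ⟨coeff 0 (p.1 - s) / coeff 0 (p₀.1 - s₀), Subtype.ext (Subtype.ext ?_)⟩
      have h := smul_eq_smul_of_orthogonal hpos p₀.2 p.2 ho₀ ho hs₀ hs hr₀ hr
        (c := coeff 0 (p.1 - s) / coeff 0 (p₀.1 - s₀)) (c' := 1)
        (by rw [div_mul_cancel₀ _ hc₀, one_mul])
      simpa using h
    · push Not at hbot
      rw [(Submodule.eq_bot_iff _).2 hbot, finrank_bot]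
      exact zero_le_one
  rcases Nat.even_or_odd' n with ⟨k, hk | hk⟩
  · have h0 : finrank ℝ (LinearMap.ker Φ) = 0 := by
      rw [Submodule.finrank_eq_zero, Submodule.eq_bot_iff]
      intro p hp
      obtain ⟨s, hs, ho, hr, hc⟩ := hker p hp
      exact hzero p hp s hs ho hr (hc ⟨k, by omega⟩)
    omega
  · omega

end Cubature

lemma eval_reflect (v : Fin 2 → ℝ) (p : MvPolynomial (Fin 2) ℝ) :
    eval v (reflect p) = eval (-v) p := by
  induction p using MvPolynomial.induction_on with
  | C a => simp [reflect]
  | add p q hp hq => simp [hp, hq]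
  | mul_X p i hp => rw [map_mul, map_mul, hp]; simp [reflect]

end Moller

theorem stmt6 (μ : Measure (ℝ × ℝ)) [IsFiniteMeasure μ]
    (hcomp : ∃ K : Set (ℝ × ℝ), IsCompact K ∧ μ Kᶜ = 0)
    (hpos : ∀ P : MvPolynomial (Fin 2) ℝ, P ≠ 0 →
      0 < ∫ z, (MvPolynomial.eval ![z.1, z.2] P) ^ 2 ∂μ)
    (hsym : μ.map (fun z : ℝ × ℝ => -z) = μ)
    (n : ℕ) (hn : 1 ≤ n)
    (N : ℕ) (x : Fin N → ℝ × ℝ) (lam : Fin N → ℝ)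
    (hxinj : Function.Injective x) (hlam : ∀ k, 0 < lam k)
    (hcub : ∀ f : MvPolynomial (Fin 2) ℝ, f.totalDegree ≤ 2*n - 1 →
      (∫ z, MvPolynomial.eval ![z.1, z.2] f ∂μ) =
        ∑ k, lam k * MvPolynomial.eval ![(x k).1, (x k).2] f) :
    N ≥ n * (n+1) / 2 + n / 2 := by
  obtain ⟨K, hK, hμK⟩ := hcomp
  have hcont : ∀ f : MvPolynomial (Fin 2) ℝ,
      Continuous fun z : ℝ × ℝ => MvPolynomial.eval ![z.1, z.2] f := fun f =>
    (MvPolynomial.continuous_eval f).comp (by fun_prop)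
  have hint : ∀ f : MvPolynomial (Fin 2) ℝ,
      Integrable (fun z : ℝ × ℝ => MvPolynomial.eval ![z.1, z.2] f) μ := by
    intro f
    have h := (hcont f).continuousOn.integrableOn_compact (μ := μ) hK
    rwa [IntegrableOn, Measure.restrict_eq_self_of_ae_mem (mem_ae_iff.2 hμK)] at h
  let L : MvPolynomial (Fin 2) ℝ →ₗ[ℝ] ℝ :=
    { toFun := fun f => ∫ z, MvPolynomial.eval ![z.1, z.2] f ∂μ
      map_add' := fun f g => by
        simp only [map_add]
        exact integral_add (hint f) (hint g)
      map_smul' := fun c f => by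
        simp only [MvPolynomial.smul_eval, RingHom.id_apply, smul_eq_mul]
        exact integral_const_mul c _ }
  let E : MvPolynomial (Fin 2) ℝ →ₐ[ℝ] (Fin N → ℝ) :=
    AlgHom.pi fun k => MvPolynomial.aeval ![(x k).1, (x k).2]
  have h := Moller.le_finrank (L := L) (E := E) (n := n) ?_ ?_ hn ?_
  · simpa using h
  · intro p hp
    have := hpos p hp
    simpa [L, pow_two] using this
  · intro p
    have h : ∫ z, MvPolynomial.eval ![z.1, z.2] p ∂(μ.map fun z : ℝ × ℝ => -z) =
        ∫ z : ℝ × ℝ, MvPolynomial.eval ![(-z).1, (-z).2] p ∂μ :=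
      integral_map measurable_neg.aemeasurable (hcont p).aestronglyMeasurable
    rw [hsym] at h
    change ∫ z, MvPolynomial.eval ![z.1, z.2] (Moller.reflect p) ∂μ =
      ∫ z, MvPolynomial.eval ![z.1, z.2] p ∂μ
    rw [h]
    simp [Moller.eval_reflect]
  · intro f hf hE
    refine (hcub f hf).trans (Finset.sum_eq_zero fun k _ => ?_)
    have h : MvPolynomial.eval ![(x k).1, (x k).2] f = 0 := by
      simpa [E, MvPolynomial.aeval_eq_eval] using congrFun hE k
    rw [h, mul_zero]
end

section
/- Let n ≥ 1 and suppose x⁽¹⁾,…,x⁽ᴺ⁾ are distinct points of ℝ² and λ_1,…,λ_N are positive real numbers such that ∫ f dμ = Σ_{k=1}^{N} λ_k f(x⁽ᵏ⁾) for every f ∈ Π²_{2n-1}. Then N = n(n+1)/2 + ⌊n/2⌋ (i.e. the cubature rule attains Möller's lower bound) if and only if there exist n + 1 − ⌊n/2⌋ linearly independent polynomials p ∈ Π²_n, each satisfying ∫ p·q dμ = 0 for all q ∈ Π²_{n-1}, such that every node x⁽ᵏ⁾ is a common zero of all of them. -/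
namespace MoellerCubature

/-- Bivariate real polynomials all of whose monomials have total degree in `D`. -/
noncomputable def degreeIn (D : Finset ℕ) : Submodule ℝ (MvPolynomial (Fin 2) ℝ) :=
  MvPolynomial.restrictSupport ℝ {s | s.degree ∈ D}

/-- The natural numbers `k ≤ d` of the same parity as `d`. -/
def sameParity (d : ℕ) : Finset ℕ := (Finset.range (d + 1)).filter fun k => k % 2 = d % 2

theorem degreeIn_eq_restrictSupport_finset (D : Finset ℕ) :
    degreeIn D = MvPolynomial.restrictSupport ℝ
      (((D.sigma fun k => Finset.HasAntidiagonal.antidiagonal k).image fun z =>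
        (Finsupp.equivFunOnFinite.symm ![z.2.1, z.2.2] : Fin 2 →₀ ℕ)) : Finset (Fin 2 →₀ ℕ)) := by
  rw [degreeIn]
  congr 1
  ext s
  simp only [Set.mem_ofPred_eq, Finset.coe_image, Set.mem_image, Finset.mem_coe, Finset.mem_sigma,
    Finset.HasAntidiagonal.mem_antidiagonal]
  constructor
  · intro h
    refine ⟨⟨s.degree, (s 0, s 1)⟩, ⟨h, ?_⟩, ?_⟩
    · simp [Finsupp.degree_eq_sum]
    · ext i
      fin_cases i <;> simp
  · rintro ⟨⟨k, a, b⟩, ⟨hk, hab⟩, rfl⟩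
    simp only at hab hk
    simpa [Finsupp.degree_eq_sum, hab] using hk

instance finiteDimensional_degreeIn (D : Finset ℕ) : FiniteDimensional ℝ (degreeIn D) := by
  rw [degreeIn_eq_restrictSupport_finset]
  exact Module.Finite.of_basis (MvPolynomial.basisRestrictSupport ℝ _)

theorem finrank_degreeIn (D : Finset ℕ) :
    Module.finrank ℝ (degreeIn D) = ∑ k ∈ D, (k + 1) := by
  rw [degreeIn_eq_restrictSupport_finset,
    Module.finrank_eq_card_basis (MvPolynomial.basisRestrictSupport ℝ _)]
  simp only [Finset.coe_sort_coe, Fintype.card_coe]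
  rw [Finset.card_image_of_injOn, Finset.card_sigma]
  · simp
  · rintro ⟨k, a, b⟩ h ⟨k', a', b'⟩ h' heq
    simp only [Finset.coe_sigma, Set.mem_sigma_iff,
      Finset.mem_coe, Finset.HasAntidiagonal.mem_antidiagonal] at h h'
    have h0 := DFunLike.congr_fun heq 0
    have h1 := DFunLike.congr_fun heq 1
    simp at h0 h1
    obtain rfl : k = k' := by omega
    simp [h0, h1]

theorem mem_degreeIn_range {n : ℕ} {p : MvPolynomial (Fin 2) ℝ} :
    p ∈ degreeIn (Finset.range (n + 1)) ↔ p.totalDegree ≤ n := by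
  rw [← MvPolynomial.mem_restrictTotalDegree, degreeIn, MvPolynomial.restrictTotalDegree]
  simp only [Finset.mem_range, Nat.lt_add_one_iff]
  rfl

theorem degreeIn_mono {D D' : Finset ℕ} (h : D ⊆ D') : degreeIn D ≤ degreeIn D' :=
  MvPolynomial.restrictSupport_mono ℝ fun _ hs => h hs

theorem totalDegree_le_of_mem_sameParity {d : ℕ} {p : MvPolynomial (Fin 2) ℝ}
    (hp : p ∈ degreeIn (sameParity d)) : p.totalDegree ≤ d :=
  mem_degreeIn_range.1 (degreeIn_mono (Finset.filter_subset _ _) hp)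

theorem degreeIn_range_le (n : ℕ) (hn : 1 ≤ n) :
    degreeIn (Finset.range (n + 1)) ≤
      degreeIn (sameParity (n - 1)) ⊔ degreeIn (sameParity n) := by
  simp only [degreeIn, MvPolynomial.restrictSupport_eq_span]
  rw [← Submodule.span_union, ← Set.image_union]
  refine Submodule.span_mono (Set.image_mono fun s hs => ?_)
  simp only [sameParity, Finset.mem_range, Set.mem_union, Set.mem_ofPred_eq,
    Finset.mem_filter] at hs ⊢
  omega

theorem X_mul_mem_degreeIn {D D' : Finset ℕ} (h : ∀ k ∈ D, k + 1 ∈ D') (i : Fin 2)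
    {p : MvPolynomial (Fin 2) ℝ} (hp : p ∈ degreeIn D) : MvPolynomial.X i * p ∈ degreeIn D' := by
  have hX : (MvPolynomial.X i : MvPolynomial (Fin 2) ℝ) ∈
      MvPolynomial.restrictSupport ℝ {Finsupp.single i 1} :=
    (MvPolynomial.monomial_mem_restrictSupport ℝ).2 (Or.inl rfl)
  have := Submodule.mul_mem_mul hX hp
  rw [degreeIn, ← MvPolynomial.restrictSupport_add] at this
  refine MvPolynomial.restrictSupport_mono ℝ ?_ this
  rintro _ ⟨a, rfl, b, hb, rfl⟩
  simpa [add_comm] using h _ hb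

theorem X_mul_mem_sameParity {n : ℕ} (hn : 1 ≤ n) (i : Fin 2) {p : MvPolynomial (Fin 2) ℝ}
    (hp : p ∈ degreeIn (sameParity (n - 1))) :
    MvPolynomial.X i * p ∈ degreeIn (sameParity n) := by
  refine X_mul_mem_degreeIn (fun k hk => ?_) i hp
  simp only [sameParity, Finset.mem_filter, Finset.mem_range] at hk ⊢
  omega

theorem eval_neg_of_mem_sameParity {d : ℕ} {p : MvPolynomial (Fin 2) ℝ}
    (hp : p ∈ degreeIn (sameParity d)) (v : Fin 2 → ℝ) :
    MvPolynomial.eval (-v) p = (-1) ^ d * MvPolynomial.eval v p := by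
  rw [MvPolynomial.eval_eq', MvPolynomial.eval_eq', Finset.mul_sum]
  refine Finset.sum_congr rfl fun s hs => ?_
  have h := hp hs
  simp only [sameParity, Finset.mem_filter, Set.mem_ofPred_eq, Finsupp.degree_eq_sum,
    Fin.sum_univ_two] at h
  have hpow : (-1 : ℝ) ^ (s 0 + s 1) = (-1) ^ d := by
    rw [neg_one_pow_eq_pow_mod_two, h.2, ← neg_one_pow_eq_pow_mod_two]
  rw [← hpow, Fin.prod_univ_two, Fin.prod_univ_two, Pi.neg_apply, Pi.neg_apply, neg_pow (v 0),
    neg_pow (v 1)]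
  ring

theorem eval_zero_of_mem_sameParity_odd {d : ℕ} (hd : d % 2 = 1) {p : MvPolynomial (Fin 2) ℝ}
    (hp : p ∈ degreeIn (sameParity d)) : MvPolynomial.eval 0 p = 0 := by
  have h := eval_neg_of_mem_sameParity hp 0
  rw [neg_zero, (Nat.odd_iff.2 hd).neg_one_pow] at h
  linarith

theorem two_mul_finrank_sameParity (d : ℕ) :
    2 * Module.finrank ℝ (degreeIn (sameParity d)) =
      (d + 1) * (d + 2) / 2 + (d + 1) / 2 + (d + 1) % 2 := by
  rw [finrank_degreeIn]
  induction d using Nat.twoStepInduction with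
  | zero => decide
  | one => decide
  | more d ih _ =>
    have : sameParity (d + 2) = insert (d + 2) (sameParity d) := by
      ext k
      simp only [sameParity, Finset.mem_filter, Finset.mem_range, Finset.mem_insert]
      omega
    rw [this, Finset.sum_insert (by simp [sameParity]), mul_add, ih,
      show (d + 2 + 1) * (d + 2 + 2) = (d + 1) * (d + 2) + (2 * d + 5) * 2 by ring,
      Nat.add_mul_div_right _ _ two_pos]
    omega

theorem finrank_degreeIn_range (n : ℕ) :
    Module.finrank ℝ (degreeIn (Finset.range (n + 1))) =
      n * (n + 1) / 2 + n / 2 + (n + 1 - n / 2) := by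
  rw [finrank_degreeIn]
  have h : ∑ k ∈ Finset.range (n + 1), (k + 1) = n * (n + 1) / 2 + (n + 1) := by
    rw [Finset.sum_add_distrib, Finset.sum_range_id]
    simp [mul_comm]
  omega

/-- Evaluation of bivariate polynomials at the points `x k`. -/
noncomputable def nodeEval {N : ℕ} (x : Fin N → ℝ × ℝ) :
    MvPolynomial (Fin 2) ℝ →ₐ[ℝ] (Fin N → ℝ) :=
  AlgHom.pi fun k => MvPolynomial.aeval ![(x k).1, (x k).2]

@[simp]
theorem nodeEval_apply {N : ℕ} (x : Fin N → ℝ × ℝ) (p : MvPolynomial (Fin 2) ℝ) (k : Fin N) :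
    nodeEval x p k = MvPolynomial.eval ![(x k).1, (x k).2] p := by
  simp [nodeEval, MvPolynomial.aeval_eq_eval]

/-- The restrictions to the nodes of the polynomials of degree at most `d` and of the parity
of `d`. -/
noncomputable def nodeSpace {N : ℕ} (x : Fin N → ℝ × ℝ) (d : ℕ) : Submodule ℝ (Fin N → ℝ) :=
  (degreeIn (sameParity d)).map (nodeEval x).toLinearMap

theorem mem_nodeSpace {N : ℕ} {x : Fin N → ℝ × ℝ} {d : ℕ} {v : Fin N → ℝ} :
    v ∈ nodeSpace x d ↔ ∃ p ∈ degreeIn (sameParity d), nodeEval x p = v := Iff.rfl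

theorem exists_linear_ne_zero {N : ℕ} (x : Fin N → ℝ × ℝ) :
    ∃ c : ℝ, ∀ k, (x k).1 + c * (x k).2 = 0 → x k = 0 := by
  obtain ⟨c, hc⟩ := Infinite.exists_notMem_finset
    (Finset.univ.image fun k => -(x k).1 / (x k).2)
  refine ⟨c, fun k hk => ?_⟩
  by_cases h2 : (x k).2 = 0
  · rw [h2, mul_zero, add_zero] at hk
    exact Prod.ext hk h2
  · refine absurd (Finset.mem_image.2 ⟨k, Finset.mem_univ k, ?_⟩) hc
    field_simp
    linarith

/-- The values at the nodes of the linear form `X + c Y`. -/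
def linearValue {N : ℕ} (x : Fin N → ℝ × ℝ) (c : ℝ) : Fin N → ℝ :=
  fun k => (x k).1 + c * (x k).2

theorem nodeEval_linear {N : ℕ} (x : Fin N → ℝ × ℝ) (c : ℝ) :
    nodeEval x (MvPolynomial.X 0 + MvPolynomial.C c * MvPolynomial.X 1) = linearValue x c := by
  ext k
  simp [linearValue]

theorem linear_mul_mem_sameParity {n : ℕ} (hn : 1 ≤ n) (c : ℝ) {p : MvPolynomial (Fin 2) ℝ}
    (hp : p ∈ degreeIn (sameParity (n - 1))) :
    (MvPolynomial.X 0 + MvPolynomial.C c * MvPolynomial.X 1) * p ∈ degreeIn (sameParity n) := by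
  rw [add_mul, mul_assoc, ← MvPolynomial.smul_eq_C_mul]
  exact add_mem (X_mul_mem_sameParity hn 0 hp)
    (Submodule.smul_mem _ _ (X_mul_mem_sameParity hn 1 hp))

theorem linearValue_mul_mem {N n : ℕ} (hn : 1 ≤ n) (x : Fin N → ℝ × ℝ) (c : ℝ)
    {v : Fin N → ℝ} (hv : v ∈ nodeSpace x (n - 1)) : linearValue x c * v ∈ nodeSpace x n := by
  obtain ⟨p, hp, rfl⟩ := mem_nodeSpace.1 hv
  rw [← nodeEval_linear, ← map_mul]
  exact mem_nodeSpace.2 ⟨_, linear_mul_mem_sameParity hn c hp, rfl⟩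

theorem snd_mul_mem {N n : ℕ} (hn : 1 ≤ n) (x : Fin N → ℝ × ℝ)
    {v : Fin N → ℝ} (hv : v ∈ nodeSpace x (n - 1)) :
    (fun k => (x k).2 * v k) ∈ nodeSpace x n := by
  obtain ⟨p, hp, rfl⟩ := mem_nodeSpace.1 hv
  refine mem_nodeSpace.2 ⟨_, X_mul_mem_sameParity hn 1 hp, ?_⟩
  ext k
  simp

theorem zero_point : ![(0 : ℝ × ℝ).1, (0 : ℝ × ℝ).2] = 0 := by
  ext i
  fin_cases i <;> rfl

theorem apply_eq_zero_of_odd {N d : ℕ} {x : Fin N → ℝ × ℝ} (hd : d % 2 = 1) {v : Fin N → ℝ}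
    (hv : v ∈ nodeSpace x d) {k : Fin N} (hk : x k = 0) : v k = 0 := by
  obtain ⟨p, hp, rfl⟩ := mem_nodeSpace.1 hv
  rw [nodeEval_apply, hk, zero_point, eval_zero_of_mem_sameParity_odd hd hp]

theorem apply_eq_zero_of_linearValue_mul {N : ℕ} {x : Fin N → ℝ × ℝ} {c : ℝ}
    (hc : ∀ k, (x k).1 + c * (x k).2 = 0 → x k = 0) {v : Fin N → ℝ}
    (hv : linearValue x c * v = 0) {k : Fin N} (hk : x k ≠ 0) : v k = 0 :=
  (mul_eq_zero.1 (congrFun hv k)).resolve_left fun h0 => hk (hc k h0)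

theorem finrank_ker_linearValue_le {N n : ℕ} (hn : 1 ≤ n) {x : Fin N → ℝ × ℝ}
    (hx : Function.Injective x) {c : ℝ} (hc : ∀ k, (x k).1 + c * (x k).2 = 0 → x k = 0) :
    Module.finrank ℝ (LinearMap.ker
      ((LinearMap.mulLeft ℝ (linearValue x c)).domRestrict (nodeSpace x (n - 1)))) ≤ n % 2 := by
  have hker : ∀ v : LinearMap.ker
      ((LinearMap.mulLeft ℝ (linearValue x c)).domRestrict (nodeSpace x (n - 1))),
      ∀ k, x k ≠ 0 → v.1.1 k = 0 := by
    intro v k hk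
    exact apply_eq_zero_of_linearValue_mul hc (LinearMap.mem_ker.1 v.2) hk
  rcases Nat.mod_two_eq_zero_or_one n with h | h
  · rw [h, Nat.le_zero, Submodule.finrank_eq_zero, Submodule.eq_bot_iff]
    intro v hv
    ext k
    by_cases hk : x k = 0
    · exact apply_eq_zero_of_odd (by omega) v.2 hk
    · exact hker ⟨v, hv⟩ k hk
  · rw [h]
    by_cases hz : ∃ v : LinearMap.ker
      ((LinearMap.mulLeft ℝ (linearValue x c)).domRestrict (nodeSpace x (n - 1))), v ≠ 0
    · obtain ⟨v, hv⟩ := hz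
      obtain ⟨k₀, hk₀⟩ : ∃ k, v.1.1 k ≠ 0 := by
        by_contra! hcon
        exact hv (by ext k; exact hcon k)
      have hxk₀ : x k₀ = 0 := by
        by_contra h0
        exact hk₀ (hker v k₀ h0)
      refine finrank_le_one v fun w => ⟨w.1.1 k₀ / v.1.1 k₀, ?_⟩
      ext k
      by_cases hk : x k = 0
      · obtain rfl := hx (hk.trans hxk₀.symm)
        simp [hk₀]
      · simp [hker v k hk, hker w k hk]
    · push Not at hz
      exact finrank_le_one 0 fun w => ⟨0, by rw [hz w, smul_zero]⟩

theorem finrank_nodeSpace {N n : ℕ} {x : Fin N → ℝ × ℝ}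
    (hinj : ∀ p ∈ degreeIn (sameParity n), nodeEval x p = 0 → p = 0) :
    2 * Module.finrank ℝ (nodeSpace x n) = (n + 1) * (n + 2) / 2 + (n + 1) / 2 + (n + 1) % 2 := by
  have hker : LinearMap.ker
      ((nodeEval x).toLinearMap.domRestrict (degreeIn (sameParity n))) = ⊥ := by
    rw [Submodule.eq_bot_iff]
    exact fun p hp => Subtype.ext (hinj p p.2 hp)
  rw [← two_mul_finrank_sameParity, nodeSpace, ← LinearMap.range_domRestrict,
    LinearMap.finrank_range_of_inj (LinearMap.ker_eq_bot.1 hker)]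

theorem map_linearValue_le {N n : ℕ} (hn : 1 ≤ n) (x : Fin N → ℝ × ℝ) (c : ℝ) :
    (nodeSpace x (n - 1)).map (LinearMap.mulLeft ℝ (linearValue x c)) ≤ nodeSpace x n := by
  rintro _ ⟨v, hv, rfl⟩
  exact linearValue_mul_mem hn x c hv

theorem finrank_map_linearValue {N n : ℕ} (x : Fin N → ℝ × ℝ) (c : ℝ) :
    Module.finrank ℝ ((nodeSpace x n).map (LinearMap.mulLeft ℝ (linearValue x c))) +
      Module.finrank ℝ (LinearMap.ker
        ((LinearMap.mulLeft ℝ (linearValue x c)).domRestrict (nodeSpace x n))) =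
      Module.finrank ℝ (nodeSpace x n) := by
  rw [← LinearMap.range_domRestrict]
  exact LinearMap.finrank_range_add_finrank_ker _

theorem moeller_lower_bound {N n : ℕ} (hn : 1 ≤ n) {x : Fin N → ℝ × ℝ}
    (hx : Function.Injective x)
    (hinj : ∀ p ∈ degreeIn (sameParity (n - 1)), nodeEval x p = 0 → p = 0)
    (hdisj : Disjoint (nodeSpace x (n - 1)) (nodeSpace x n)) :
    n * (n + 1) / 2 + n / 2 ≤
      Module.finrank ℝ (nodeSpace x (n - 1) ⊔ nodeSpace x n : Submodule ℝ (Fin N → ℝ)) := by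
  obtain ⟨c, hc⟩ := exists_linear_ne_zero x
  have h1 := finrank_nodeSpace hinj
  rw [show n - 1 + 2 = n + 1 by omega, show n - 1 + 1 = n by omega] at h1
  have h2 := finrank_ker_linearValue_le hn hx hc
  have h3 := finrank_map_linearValue (n := n - 1) x c
  have h4 := Submodule.finrank_mono (map_linearValue_le hn x c)
  have h5 := Submodule.finrank_sup_add_finrank_inf_eq (nodeSpace x (n - 1)) (nodeSpace x n)
  rw [hdisj.eq_bot, finrank_bot, add_zero] at h5
  omega

/-- If Möller's bound is attained then multiplication by a linear form not vanishing at the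
nonzero nodes maps onto the node space of degree `n`. -/
theorem map_linearValue_eq {N n : ℕ} (hn : 1 ≤ n) {x : Fin N → ℝ × ℝ}
    (hx : Function.Injective x)
    (hinj : ∀ p ∈ degreeIn (sameParity (n - 1)), nodeEval x p = 0 → p = 0)
    (hdisj : Disjoint (nodeSpace x (n - 1)) (nodeSpace x n))
    (hle : Module.finrank ℝ (nodeSpace x (n - 1) ⊔ nodeSpace x n : Submodule ℝ (Fin N → ℝ)) ≤
      n * (n + 1) / 2 + n / 2)
    {c : ℝ} (hc : ∀ k, (x k).1 + c * (x k).2 = 0 → x k = 0) :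
    (nodeSpace x (n - 1)).map (LinearMap.mulLeft ℝ (linearValue x c)) = nodeSpace x n ∧
      Module.finrank ℝ (LinearMap.ker
        ((LinearMap.mulLeft ℝ (linearValue x c)).domRestrict (nodeSpace x (n - 1)))) = n % 2 := by
  have h1 := finrank_nodeSpace hinj
  rw [show n - 1 + 2 = n + 1 by omega, show n - 1 + 1 = n by omega] at h1
  have h2 := finrank_ker_linearValue_le hn hx hc
  have h3 := finrank_map_linearValue (n := n - 1) x c
  have h4 := Submodule.finrank_mono (map_linearValue_le hn x c)
  have h5 := Submodule.finrank_sup_add_finrank_inf_eq (nodeSpace x (n - 1)) (nodeSpace x n)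
  rw [hdisj.eq_bot, finrank_bot, add_zero] at h5
  exact ⟨Submodule.eq_of_le_of_finrank_le (map_linearValue_le hn x c) (by omega), by omega⟩

/-- If Möller's bound is attained, some polynomial of degree at most `n` takes the value `1` at
the origin and vanishes at all nonzero nodes, and its node values lie in the node spaces. -/
theorem exists_separating {N n : ℕ} (hn : 1 ≤ n) {x : Fin N → ℝ × ℝ}
    {c : ℝ} (hc : ∀ k, (x k).1 + c * (x k).2 = 0 → x k = 0)
    (hmap : (nodeSpace x (n - 1)).map (LinearMap.mulLeft ℝ (linearValue x c)) = nodeSpace x n)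
    (hker : Module.finrank ℝ (LinearMap.ker
        ((LinearMap.mulLeft ℝ (linearValue x c)).domRestrict (nodeSpace x (n - 1)))) = n % 2) :
    ∃ u : MvPolynomial (Fin 2) ℝ, u.totalDegree ≤ n ∧ MvPolynomial.eval 0 u = 1 ∧
      (∀ k, x k ≠ 0 → nodeEval x u k = 0) ∧
      nodeEval x u ∈ nodeSpace x (n - 1) ⊔ nodeSpace x n := by
  rcases Nat.mod_two_eq_zero_or_one n with h | h
  · have h1 : (1 : MvPolynomial (Fin 2) ℝ) ∈ degreeIn (sameParity n) := by
      refine (MvPolynomial.monomial_mem_restrictSupport ℝ).2 (Or.inl ?_)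
      simp [sameParity, h]
    have hone : nodeEval x 1 ∈ nodeSpace x n := mem_nodeSpace.2 ⟨1, h1, rfl⟩
    rw [← hmap] at hone
    obtain ⟨_, hv, hvone⟩ := hone
    obtain ⟨g, hg, rfl⟩ := mem_nodeSpace.1 hv
    have hlg := linear_mul_mem_sameParity hn c hg
    have hu : nodeEval x
        (1 - (MvPolynomial.X 0 + MvPolynomial.C c * MvPolynomial.X 1) * g) = 0 := by
      rw [map_sub, ← hvone, LinearMap.mulLeft_apply, map_mul, nodeEval_linear, sub_self]
    refine ⟨_, totalDegree_le_of_mem_sameParity (sub_mem h1 hlg), ?_, ?_, ?_⟩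
    · simp
    · rw [hu]
      simp
    · rw [hu]
      exact zero_mem _
  · obtain ⟨v, hv⟩ : ∃ v : LinearMap.ker
      ((LinearMap.mulLeft ℝ (linearValue x c)).domRestrict (nodeSpace x (n - 1))), v ≠ 0 := by
      have : Nontrivial (LinearMap.ker
        ((LinearMap.mulLeft ℝ (linearValue x c)).domRestrict (nodeSpace x (n - 1)))) :=
        Module.nontrivial_of_finrank_pos (R := ℝ) (by omega)
      exact exists_ne 0
    have hv0 : ∀ k, x k ≠ 0 → v.1.1 k = 0 := by
      intro k hk
      exact apply_eq_zero_of_linearValue_mul hc (LinearMap.mem_ker.1 v.2) hk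
    obtain ⟨k₀, hk₀⟩ : ∃ k, v.1.1 k ≠ 0 := by
      by_contra! hcon
      exact hv (by ext k; exact hcon k)
    have hxk₀ : x k₀ = 0 := by
      by_contra h0
      exact hk₀ (hv0 k₀ h0)
    obtain ⟨g, hg, hgv⟩ := mem_nodeSpace.1 v.1.2
    have hu : nodeEval x ((v.1.1 k₀)⁻¹ • g) = (v.1.1 k₀)⁻¹ • v.1.1 := by rw [map_smul, hgv]
    refine ⟨(v.1.1 k₀)⁻¹ • g, ?_, ?_, ?_, ?_⟩
    · exact (totalDegree_le_of_mem_sameParity (Submodule.smul_mem _ _ hg)).trans (by omega)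
    · have := congrFun hgv k₀
      rw [nodeEval_apply, hxk₀, zero_point] at this
      rw [MvPolynomial.smul_eval, this, inv_mul_cancel₀ hk₀]
    · intro k hk
      rw [hu, Pi.smul_apply, hv0 k hk, smul_zero]
    · rw [hu]
      exact Submodule.mem_sup_left (Submodule.smul_mem _ _ v.1.2)

/-- The slopes `Y / (X + c Y)` of the nodes; nodes on a common line through the origin have the
same slope. -/
noncomputable def slope {N : ℕ} (x : Fin N → ℝ × ℝ) (c : ℝ) : Fin N → ℝ :=
  fun k => (x k).2 / linearValue x c k

theorem eq_linearValue_smul {N : ℕ} {x : Fin N → ℝ × ℝ} {c : ℝ}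
    (hc : ∀ k, (x k).1 + c * (x k).2 = 0 → x k = 0) (k : Fin N) :
    x k = linearValue x c k • (1 - c * slope x c k, slope x c k) := by
  by_cases hk : linearValue x c k = 0
  · rw [hk, zero_smul, hc k hk]
  · ext
    · simp only [Prod.smul_mk, smul_eq_mul, slope]
      field_simp
      simp [linearValue]
    · simp only [Prod.smul_mk, smul_eq_mul, slope]
      field_simp

theorem slope_mul_mem {N n : ℕ} (hn : 1 ≤ n) {x : Fin N → ℝ × ℝ} {c : ℝ}
    (hc : ∀ k, (x k).1 + c * (x k).2 = 0 → x k = 0)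
    (hmap : (nodeSpace x (n - 1)).map (LinearMap.mulLeft ℝ (linearValue x c)) = nodeSpace x n)
    {v : Fin N → ℝ} (hv : v ∈ nodeSpace x n) : slope x c * v ∈ nodeSpace x n := by
  rw [← hmap] at hv
  obtain ⟨w, hw, rfl⟩ := hv
  convert snd_mul_mem hn x hw using 1
  ext k
  simp only [slope, Pi.mul_apply, LinearMap.mulLeft_apply]
  by_cases hk : linearValue x c k = 0
  · rw [hk, hc k hk]
    simp
  · field_simp

theorem aeval_mul_mem {N : ℕ} {B : Submodule ℝ (Fin N → ℝ)} {s : Fin N → ℝ}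
    (hs : ∀ v ∈ B, s * v ∈ B) (P : Polynomial ℝ) {v : Fin N → ℝ} (hv : v ∈ B) :
    Polynomial.aeval s P * v ∈ B := by
  induction P using Polynomial.induction_on generalizing v with
  | C a =>
    rw [Polynomial.aeval_C, ← Algebra.smul_def]
    exact B.smul_mem a hv
  | add P Q hP hQ =>
    rw [map_add, add_mul]
    exact B.add_mem (hP hv) (hQ hv)
  | monomial m a h =>
    rw [pow_succ, ← mul_assoc, map_mul, Polynomial.aeval_X, mul_assoc]
    exact h (hs v hv)

/-- A space of functions stable under multiplication by `s` is stable under restriction to the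
level sets of `s`. -/
theorem indicator_mem {N : ℕ} {B : Submodule ℝ (Fin N → ℝ)} {s : Fin N → ℝ}
    (hs : ∀ v ∈ B, s * v ∈ B) (t : ℝ) {v : Fin N → ℝ} (hv : v ∈ B) :
    {k | s k = t}.indicator v ∈ B := by
  classical
  have h := aeval_mul_mem hs
    (Lagrange.interpolate (Finset.univ.image s) id fun r => if r = t then 1 else 0) hv
  convert h using 1
  ext k
  rw [Pi.mul_apply, Polynomial.aeval_pi_apply₂, Polynomial.coe_aeval_eq_eval,
    ← id_eq (s k), Lagrange.eval_interpolate_at_node _ (Set.injOn_id _)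
      (Finset.mem_image_of_mem s (Finset.mem_univ k))]
  simp [Set.indicator_apply]

theorem mem_sup_of_supported_zero {N n : ℕ} {x : Fin N → ℝ × ℝ} (hx : Function.Injective x)
    {u : MvPolynomial (Fin 2) ℝ} (hu1 : MvPolynomial.eval 0 u = 1)
    (hu0 : ∀ k, x k ≠ 0 → nodeEval x u k = 0)
    (hu : nodeEval x u ∈ nodeSpace x (n - 1) ⊔ nodeSpace x n) {v : Fin N → ℝ}
    (hv : ∀ k, x k ≠ 0 → v k = 0) : v ∈ nodeSpace x (n - 1) ⊔ nodeSpace x n := by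
  by_cases h : ∃ k, x k = 0
  · obtain ⟨k₀, hk₀⟩ := h
    have : v = v k₀ • nodeEval x u := by
      ext k
      by_cases hk : x k = 0
      · obtain rfl := hx (hk.trans hk₀.symm)
        rw [Pi.smul_apply, nodeEval_apply, hk, zero_point, hu1, smul_eq_mul, mul_one]
      · rw [Pi.smul_apply, hv k hk, hu0 k hk, smul_zero]
    rw [this]
    exact Submodule.smul_mem _ _ hu
  · push Not at h
    have : v = 0 := funext fun k => hv k (h k)
    rw [this]
    exact zero_mem _

/-- A line through the origin contains at most `n` nonzero nodes. -/
theorem card_line_le {N n : ℕ} {x : Fin N → ℝ × ℝ} (hx : Function.Injective x) {c : ℝ}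
    (hc : ∀ k, (x k).1 + c * (x k).2 = 0 → x k = 0)
    {u : MvPolynomial (Fin 2) ℝ} (hud : u.totalDegree ≤ n) (hu1 : MvPolynomial.eval 0 u = 1)
    (hu0 : ∀ k, x k ≠ 0 → nodeEval x u k = 0) {t : ℝ} {L : Finset (Fin N)}
    (hL : ∀ k ∈ L, x k ≠ 0 ∧ slope x c k = t) : L.card ≤ n := by
  classical
  set r : Polynomial ℝ := MvPolynomial.aeval
    ![Polynomial.C (1 - c * t) * Polynomial.X, Polynomial.C t * Polynomial.X] u with hr
  have heval : ∀ a : ℝ, r.eval a = MvPolynomial.eval ![a * (1 - c * t), a * t] u := by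
    intro a
    rw [hr, ← Polynomial.coe_aeval_eq_eval, MvPolynomial.comp_aeval_apply,
      MvPolynomial.aeval_eq_eval]
    congr 2
    ext i
    fin_cases i
    · simp
      ring
    · simp
      ring
  have hrd : r.natDegree ≤ n := by
    rw [← mul_one n]
    refine MvPolynomial.aeval_natDegree_le u hud _ fun i => ?_
    fin_cases i
    · exact (Polynomial.natDegree_C_mul_le _ _).trans Polynomial.natDegree_X_le
    · exact (Polynomial.natDegree_C_mul_le _ _).trans Polynomial.natDegree_X_le
  have hr0 : r ≠ 0 := by
    intro h0
    have h := heval 0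
    rw [h0, zero_mul, zero_mul, Polynomial.eval_zero] at h
    have hz : ![(0 : ℝ), 0] = 0 := zero_point
    rw [hz, hu1] at h
    exact zero_ne_one h
  have hinj : Set.InjOn (linearValue x c) L := by
    intro k hk l hl hkl
    apply hx
    rw [eq_linearValue_smul hc k, eq_linearValue_smul hc l, hkl, (hL k hk).2, (hL l hl).2]
  rw [← Finset.card_image_of_injOn hinj]
  refine (Polynomial.card_le_degree_of_subset_roots ?_).trans hrd
  intro a ha
  obtain ⟨k, hk, rfl⟩ := Finset.mem_image.1 ha
  rw [Polynomial.mem_roots hr0, Polynomial.IsRoot, heval]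
  have h := hu0 k (hL k hk).1
  rw [nodeEval_apply, eq_linearValue_smul hc k, (hL k hk).2] at h
  exact h

theorem sup_nodeSpace_eq_top {N n : ℕ} (hn : 1 ≤ n) {x : Fin N → ℝ × ℝ}
    (hx : Function.Injective x)
    (hinj : ∀ p ∈ degreeIn (sameParity (n - 1)), nodeEval x p = 0 → p = 0)
    (hdisj : Disjoint (nodeSpace x (n - 1)) (nodeSpace x n))
    (hle : Module.finrank ℝ (nodeSpace x (n - 1) ⊔ nodeSpace x n : Submodule ℝ (Fin N → ℝ)) ≤
      n * (n + 1) / 2 + n / 2) :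
    nodeSpace x (n - 1) ⊔ nodeSpace x n = ⊤ := by
  classical
  obtain ⟨c, hc⟩ := exists_linear_ne_zero x
  obtain ⟨hmap, hker⟩ := map_linearValue_eq hn hx hinj hdisj hle hc
  obtain ⟨u, hud, hu1, hu0, hu⟩ := exists_separating hn hc hmap hker
  have hzero : ∀ {v : Fin N → ℝ}, (∀ k, x k ≠ 0 → v k = 0) →
      v ∈ nodeSpace x (n - 1) ⊔ nodeSpace x n := mem_sup_of_supported_zero hx hu1 hu0 hu
  have hindB : ∀ (t : ℝ) {v : Fin N → ℝ}, v ∈ nodeSpace x n →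
      {k | slope x c k = t}.indicator v ∈ nodeSpace x n := fun t _ hv =>
    indicator_mem (fun _ h => slope_mul_mem hn hc hmap h) t hv
  have hindA : ∀ (t : ℝ) {v : Fin N → ℝ}, v ∈ nodeSpace x (n - 1) →
      {k | slope x c k = t}.indicator v ∈ nodeSpace x (n - 1) ⊔ nodeSpace x n := by
    intro t v hv
    have h := hindB t (linearValue_mul_mem hn x c hv)
    rw [← hmap] at h
    obtain ⟨w, hw, hwv⟩ := h
    have hsub : w - {k | slope x c k = t}.indicator v ∈
        nodeSpace x (n - 1) ⊔ nodeSpace x n := by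
      refine hzero fun k hk => apply_eq_zero_of_linearValue_mul hc ?_ hk
      rw [mul_sub, sub_eq_zero]
      refine hwv.trans ?_
      ext l
      by_cases hl : slope x c l = t <;> simp [hl]
    simpa using sub_mem (Submodule.mem_sup_left hw) hsub
  have hind : ∀ (t : ℝ) {v : Fin N → ℝ}, v ∈ nodeSpace x (n - 1) ⊔ nodeSpace x n →
      {k | slope x c k = t}.indicator v ∈ nodeSpace x (n - 1) ⊔ nodeSpace x n := by
    intro t v hv
    obtain ⟨a, ha, b, hb, rfl⟩ := Submodule.mem_sup.1 hv
    rw [Set.indicator_add']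
    exact add_mem (hindA t ha) (Submodule.mem_sup_right (hindB t hb))
  have hsingle : ∀ k, Pi.single k (1 : ℝ) ∈ nodeSpace x (n - 1) ⊔ nodeSpace x n := by
    intro k
    by_cases hk : x k = 0
    · refine hzero fun l hl => ?_
      rw [Pi.single_eq_of_ne]
      rintro rfl
      exact hl hk
    set L : Finset (Fin N) := {l | x l ≠ 0 ∧ slope x c l = slope x c k} with hL
    have hkL : k ∈ L := by simp [hL, hk]
    have hcard : L.card ≤ n := card_line_le hx hc hud hu1 hu0 (t := slope x c k)
      fun l hl => by simpa [hL] using hl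
    set f : MvPolynomial (Fin 2) ℝ := ∏ l ∈ L.erase k,
      (MvPolynomial.X 0 + MvPolynomial.C c * MvPolynomial.X 1 -
        MvPolynomial.C (linearValue x c l)) with hf
    have hfv : ∀ j, nodeEval x f j =
        ∏ l ∈ L.erase k, (linearValue x c j - linearValue x c l) := by
      intro j
      rw [nodeEval_apply, hf, map_prod]
      simp [linearValue]
    have hfd : f.totalDegree ≤ n := by
      refine (MvPolynomial.totalDegree_finsetProd _ _).trans ?_
      refine (Finset.sum_le_card_nsmul _ _ 1 fun l _ => ?_).trans ?_
      · refine (MvPolynomial.totalDegree_sub_C_le _ _).trans ?_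
        refine (MvPolynomial.totalDegree_add _ _).trans (max_le ?_ ?_)
        · simp
        · refine (MvPolynomial.totalDegree_mul _ _).trans ?_
          simp
      · rw [smul_eq_mul, mul_one]
        exact (Finset.card_erase_le).trans hcard
    have hfmem : nodeEval x f ∈ nodeSpace x (n - 1) ⊔ nodeSpace x n := by
      rw [nodeSpace, nodeSpace, ← Submodule.map_sup]
      exact ⟨f, degreeIn_range_le n hn (mem_degreeIn_range.2 hfd), rfl⟩
    have hfk : nodeEval x f k ≠ 0 := by
      rw [hfv, Finset.prod_ne_zero_iff]
      intro l hl hkl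
      rw [Finset.mem_erase, hL, Finset.mem_filter] at hl
      refine hl.1 (hx ?_)
      rw [eq_linearValue_smul hc k, eq_linearValue_smul hc l, hl.2.2.2, sub_eq_zero.1 hkl]
    have hsub : Pi.single k (nodeEval x f k) -
        {j | slope x c j = slope x c k}.indicator (nodeEval x f) ∈
        nodeSpace x (n - 1) ⊔ nodeSpace x n := by
      refine hzero fun j hj => ?_
      by_cases hjk : j = k
      · subst hjk
        simp
      · rw [Pi.sub_apply, Pi.single_eq_of_ne hjk, zero_sub, neg_eq_zero,
          Set.indicator_apply_eq_zero]
        intro hjs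
        rw [hfv]
        exact Finset.prod_eq_zero (i := j) (by simp [hL, hjk, hj, show _ = _ from hjs])
          (sub_self _)
    have := Submodule.smul_mem _ (nodeEval x f k)⁻¹ (add_mem hsub (hind (slope x c k) hfmem))
    rwa [sub_add_cancel, ← Pi.single_smul, smul_eq_mul, inv_mul_cancel₀ hfk] at this
  rw [Submodule.eq_top_iff']
  intro v
  rw [← Finset.univ_sum_single v]
  refine Submodule.sum_mem _ fun k _ => ?_
  have := Submodule.smul_mem _ (v k) (hsingle k)
  rwa [← Pi.single_smul, smul_eq_mul, mul_one] at this

theorem map_degreeIn_range {N n : ℕ} (hn : 1 ≤ n) (x : Fin N → ℝ × ℝ) :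
    (degreeIn (Finset.range (n + 1))).map (nodeEval x).toLinearMap =
      nodeSpace x (n - 1) ⊔ nodeSpace x n := by
  refine le_antisymm ?_ (sup_le (Submodule.map_mono (degreeIn_mono ?_))
    (Submodule.map_mono (degreeIn_mono (Finset.filter_subset _ _))))
  · rw [nodeSpace, nodeSpace, ← Submodule.map_sup]
    exact Submodule.map_mono (degreeIn_range_le n hn)
  · exact (Finset.filter_subset _ _).trans (Finset.range_subset_range.2 (by omega))

theorem finrank_sup_add_finrank_ker {N n : ℕ} (hn : 1 ≤ n) (x : Fin N → ℝ × ℝ) :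
    Module.finrank ℝ (nodeSpace x (n - 1) ⊔ nodeSpace x n : Submodule ℝ (Fin N → ℝ)) +
      Module.finrank ℝ (LinearMap.ker
        ((nodeEval x).toLinearMap.domRestrict (degreeIn (Finset.range (n + 1))))) =
      n * (n + 1) / 2 + n / 2 + (n + 1 - n / 2) := by
  rw [← finrank_degreeIn_range, ← map_degreeIn_range hn, ← LinearMap.range_domRestrict]
  exact LinearMap.finrank_range_add_finrank_ker _

open MeasureTheory in
/-- Opposite parities are orthogonal for a centrally symmetric measure. -/
theorem integral_mul_eq_zero {μ : Measure (ℝ × ℝ)}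
    (hsym : μ.map (fun z : ℝ × ℝ => -z) = μ) {n : ℕ} (hn : 1 ≤ n) {f g : MvPolynomial (Fin 2) ℝ}
    (hf : f ∈ degreeIn (sameParity (n - 1))) (hg : g ∈ degreeIn (sameParity n)) :
    ∫ z, MvPolynomial.eval ![z.1, z.2] (f * g) ∂μ = 0 := by
  have h : ∫ z, MvPolynomial.eval ![z.1, z.2] (f * g) ∂μ =
      ∫ z, MvPolynomial.eval ![(-z).1, (-z).2] (f * g) ∂μ := by
    conv_lhs => rw [← hsym]
    exact integral_map_equiv (MeasurableEquiv.neg (ℝ × ℝ)) _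
  have hneg : ∀ z : ℝ × ℝ, MvPolynomial.eval ![(-z).1, (-z).2] (f * g) =
      -MvPolynomial.eval ![z.1, z.2] (f * g) := by
    intro z
    have hz : ![(-z).1, (-z).2] = -![z.1, z.2] := by
      ext i
      fin_cases i <;> rfl
    obtain ⟨m, rfl⟩ : ∃ m, n = m + 1 := ⟨n - 1, by omega⟩
    rw [hz, map_mul, map_mul, eval_neg_of_mem_sameParity hf, eval_neg_of_mem_sameParity hg,
      Nat.add_sub_cancel]
    have hs : ((-1 : ℝ) ^ m) * (-1) ^ m = 1 := by
      rw [← mul_pow]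
      simp
    rw [pow_succ]
    linear_combination (-(MvPolynomial.eval ![z.1, z.2] f * MvPolynomial.eval ![z.1, z.2] g)) * hs
  simp only [hneg, integral_neg] at h
  linarith

theorem eq_zero_of_sum_mul_self {N : ℕ} {lam v : Fin N → ℝ} (hlam : ∀ k, 0 < lam k)
    (h : ∑ k, lam k * (v k * v k) = 0) : v = 0 := by
  ext k
  have := (Finset.sum_eq_zero_iff_of_nonneg fun k _ =>
    mul_nonneg (hlam k).le (mul_self_nonneg (v k))).1 h k (Finset.mem_univ k)
  exact mul_self_eq_zero.1 ((mul_eq_zero.1 this).resolve_left (hlam k).ne')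

theorem linearIndependent_coe_coe {V ι : Type*} [AddCommGroup V] [Module ℝ V]
    {S : Submodule ℝ V} {T : Submodule ℝ S} {p : ι → T} (hp : LinearIndependent ℝ p) :
    LinearIndependent ℝ fun i => (p i).1.1 :=
  (hp.map' T.subtype T.ker_subtype).map' S.subtype S.ker_subtype

theorem linearIndependent_of_coe_coe {V ι : Type*} [AddCommGroup V] [Module ℝ V]
    {S : Submodule ℝ V} {T : Submodule ℝ S} {p : ι → T}
    (hp : LinearIndependent ℝ fun i => (p i).1.1) : LinearIndependent ℝ p :=
  LinearIndependent.of_comp (S.subtype ∘ₗ T.subtype) hp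

end MoellerCubature

open MeasureTheory Set

theorem stmt7 (μ : Measure (ℝ × ℝ)) [IsFiniteMeasure μ]
    (hcomp : ∃ K : Set (ℝ × ℝ), IsCompact K ∧ μ Kᶜ = 0)
    (hpos : ∀ P : MvPolynomial (Fin 2) ℝ, P ≠ 0 →
      0 < ∫ z, (MvPolynomial.eval ![z.1, z.2] P) ^ 2 ∂μ)
    (hsym : μ.map (fun z : ℝ × ℝ => -z) = μ)
    (n : ℕ) (hn : 1 ≤ n)
    (N : ℕ) (x : Fin N → ℝ × ℝ) (lam : Fin N → ℝ)
    (hxinj : Function.Injective x) (hlam : ∀ k, 0 < lam k)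
    (hcub : ∀ f : MvPolynomial (Fin 2) ℝ, f.totalDegree ≤ 2*n - 1 →
      (∫ z, MvPolynomial.eval ![z.1, z.2] f ∂μ) =
        ∑ k, lam k * MvPolynomial.eval ![(x k).1, (x k).2] f) :
    -- the rule attains Möller's lower bound iff the nodes are common zeros of
    -- n + 1 − ⌊n/2⌋ linearly independent orthogonal polynomials of degree n
    N = n * (n+1) / 2 + n / 2 ↔
      ∃ p : Fin (n + 1 - n / 2) → MvPolynomial (Fin 2) ℝ,
        LinearIndependent ℝ p ∧
        (∀ i, (p i).totalDegree ≤ n ∧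
          ∀ q : MvPolynomial (Fin 2) ℝ, q.totalDegree ≤ n - 1 →
            (∫ y, MvPolynomial.eval ![y.1, y.2] (p i) *
              MvPolynomial.eval ![y.1, y.2] q ∂μ) = 0) ∧
        (∀ k i, MvPolynomial.eval ![(x k).1, (x k).2] (p i) = 0) := by
  have hinj : ∀ p ∈ MoellerCubature.degreeIn (MoellerCubature.sameParity (n - 1)),
      MoellerCubature.nodeEval x p = 0 → p = 0 := by
    intro p hp h0
    by_contra hne
    refine (hpos p hne).ne' ?_
    have hd := MoellerCubature.totalDegree_le_of_mem_sameParity hp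
    simp only [← map_pow]
    rw [hcub (p ^ 2) ((MvPolynomial.totalDegree_pow _ _).trans (by omega))]
    refine Finset.sum_eq_zero fun k _ => ?_
    rw [map_pow, ← MoellerCubature.nodeEval_apply, h0]
    simp
  have hdisj : Disjoint (MoellerCubature.nodeSpace x (n - 1)) (MoellerCubature.nodeSpace x n) := by
    rw [Submodule.disjoint_def]
    intro v hv hv'
    obtain ⟨f, hf, rfl⟩ := MoellerCubature.mem_nodeSpace.1 hv
    obtain ⟨g, hg, hgf⟩ := MoellerCubature.mem_nodeSpace.1 hv'
    have hfd := MoellerCubature.totalDegree_le_of_mem_sameParity hf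
    have hgd := MoellerCubature.totalDegree_le_of_mem_sameParity hg
    have h := MoellerCubature.integral_mul_eq_zero hsym hn hf hg
    rw [hcub _ ((MvPolynomial.totalDegree_mul _ _).trans (by omega))] at h
    refine MoellerCubature.eq_zero_of_sum_mul_self hlam ?_
    rw [← h]
    refine Finset.sum_congr rfl fun k _ => ?_
    rw [map_mul, ← MoellerCubature.nodeEval_apply, ← MoellerCubature.nodeEval_apply, hgf]
  have hrank := MoellerCubature.finrank_sup_add_finrank_ker hn x
  have hlower := MoellerCubature.moeller_lower_bound hn hxinj hinj hdisj
  constructor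
  · intro hN
    have hle := Submodule.finrank_le
      (MoellerCubature.nodeSpace x (n - 1) ⊔ MoellerCubature.nodeSpace x n)
    rw [Module.finrank_fin_fun] at hle
    replace hle := hle.trans_eq hN
    obtain ⟨p, hp⟩ := exists_linearIndependent_of_le_finrank (n := n + 1 - n / 2) (R := ℝ)
      (M := LinearMap.ker ((MoellerCubature.nodeEval x).toLinearMap.domRestrict
        (MoellerCubature.degreeIn (Finset.range (n + 1))))) (by omega)
    have hp0 : ∀ i k, MvPolynomial.eval ![(x k).1, (x k).2] (p i).1.1 = 0 := by
      intro i k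
      rw [← MoellerCubature.nodeEval_apply]
      exact congrFun (LinearMap.mem_ker.1 (p i).2) k
    have hpd : ∀ i, (p i).1.1.totalDegree ≤ n := fun i =>
      MoellerCubature.mem_degreeIn_range.1 (p i).1.2
    refine ⟨fun i => (p i).1.1, ?_, fun i => ⟨hpd i, fun q hq => ?_⟩, fun k i => hp0 i k⟩
    · exact MoellerCubature.linearIndependent_coe_coe hp
    · have hpi := hpd i
      simp only [← map_mul]
      rw [hcub _ ((MvPolynomial.totalDegree_mul _ _).trans (by omega))]
      refine Finset.sum_eq_zero fun k _ => ?_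
      rw [map_mul, hp0 i k, zero_mul, mul_zero]
  · rintro ⟨p, hp, hporth, hp0⟩
    have hli : LinearIndependent ℝ fun i =>
        (⟨⟨p i, MoellerCubature.mem_degreeIn_range.2 (hporth i).1⟩, by
          rw [LinearMap.mem_ker]
          ext k
          exact (MoellerCubature.nodeEval_apply x (p i) k).trans (hp0 k i)⟩ :
          LinearMap.ker ((MoellerCubature.nodeEval x).toLinearMap.domRestrict
            (MoellerCubature.degreeIn (Finset.range (n + 1))))) :=
      MoellerCubature.linearIndependent_of_coe_coe hp
    have hcard := hli.fintype_card_le_finrank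
    rw [Fintype.card_fin] at hcard
    have htop := MoellerCubature.sup_nodeSpace_eq_top hn hxinj hinj hdisj (by omega)
    rw [htop, finrank_top, Module.finrank_fin_fun] at hrank hlower
    omega
end

section
/- Let γ ≥ -1/2, n ≥ 1, and let P be a real polynomial in two variables of total degree ≤ n such that ∫_{[-1,1]²} P(y₁+y₂, y₁y₂) g(y₁+y₂, y₁y₂) w(y₁)w(y₂) |y₁−y₂|^{2γ+1} dy₁dy₂ = 0 for every real polynomial g in two variables of total degree ≤ n−1 (i.e. P is an orthogonal polynomial of degree n for 𝒲_γ on Ω). Then the polynomial Q(x₁,x₂) := P(2x₁x₂, x₁²+x₂²−1), of total degree ≤ 2n, satisfies ∫_{[-1,1]²} Q(x₁,x₂) h(x₁,x₂) W_γ(x₁,x₂) dx₁dx₂ = 0 for every real polynomial h in two variables of total degree ≤ 2n−1. -/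
open MeasureTheory Set

noncomputable section

/-- The weight `W_γ` on the square `[-1,1]²`, with `θᵢ = arccos xᵢ`. -/
def Wsq (w : ℝ → ℝ) (γ : ℝ) (x : ℝ × ℝ) : ℝ :=
  w (Real.cos (Real.arccos x.1 - Real.arccos x.2)) *
  w (Real.cos (Real.arccos x.1 + Real.arccos x.2)) *
  (1 - x.1 ^ 2) ^ γ * (1 - x.2 ^ 2) ^ γ * |x.1 ^ 2 - x.2 ^ 2|

namespace MvPolynomial

theorem totalDegree_aeval_le {σ τ R : Type*} [CommSemiring R] {d : ℕ}
    {f : σ → MvPolynomial τ R} (hf : ∀ i, (f i).totalDegree ≤ d) (P : MvPolynomial σ R) :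
    (aeval f P).totalDegree ≤ d * P.totalDegree := by
  rw [aeval_def, eval₂_eq]
  refine totalDegree_finsetSum_le fun m hm => ?_
  refine (totalDegree_mul _ _).trans ?_
  rw [algebraMap_eq, totalDegree_C, zero_add]
  refine (totalDegree_finsetProd _ _).trans ?_
  calc ∑ i ∈ m.support, (f i ^ m i).totalDegree ≤ ∑ i ∈ m.support, d * m i :=
        Finset.sum_le_sum fun i _ => (totalDegree_pow _ _).trans (by
          rw [mul_comm]; exact Nat.mul_le_mul_right _ (hf i))
    _ = d * ∑ i ∈ m.support, m i := by rw [Finset.mul_sum]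
    _ ≤ d * P.totalDegree := Nat.mul_le_mul_left _ (le_totalDegree hm)

theorem eval_eq_sum_fin_two (x y : ℝ) (h : MvPolynomial (Fin 2) ℝ) :
    eval ![x, y] h = ∑ m ∈ h.support, h.coeff m * (x ^ m 0 * y ^ m 1) := by
  rw [eval_eq']
  simp [Fin.prod_univ_two]

end MvPolynomial

open MvPolynomial in
theorem exists_eval_eq_pow_add_pow (k : ℕ) :
    ∃ g : MvPolynomial (Fin 2) ℝ, g.totalDegree ≤ k ∧ ∀ x y : ℝ,
      eval ![2 * x * y, x ^ 2 + y ^ 2 - 1] g = (x ^ 2) ^ k + (y ^ 2) ^ k := by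
  induction k using Nat.strong_induction_on with
  | _ k ih =>
    match k with
    | 0 => exact ⟨C 2, by simp, fun x y => by simp; norm_num⟩
    | 1 =>
      refine ⟨X 1 + C 1, (totalDegree_add _ _).trans (by simp [totalDegree_X]), fun x y => ?_⟩
      simp
    | k + 2 =>
      obtain ⟨p, hp, hp'⟩ := ih k (by omega)
      obtain ⟨q, hq, hq'⟩ := ih (k + 1) (by omega)
      refine ⟨(X 1 + C 1) * q - (C (1 / 4) * X 0 ^ 2) * p, ?_, fun x y => ?_⟩
      · have h₁ : (X 1 + C 1 : MvPolynomial (Fin 2) ℝ).totalDegree ≤ 1 :=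
          (totalDegree_add _ _).trans (by simp [totalDegree_X])
        have h₂ : (C (1 / 4) * X 0 ^ 2 : MvPolynomial (Fin 2) ℝ).totalDegree ≤ 2 :=
          (totalDegree_mul _ _).trans (by rw [totalDegree_C, totalDegree_X_pow])
        refine (totalDegree_sub _ _).trans (max_le ?_ ?_)
        · exact (totalDegree_mul _ _).trans (by omega)
        · exact (totalDegree_mul _ _).trans (by omega)
      · simp only [map_sub, map_mul, map_add, hp', hq', eval_X, eval_C, map_pow]
        simp
        ring

open MvPolynomial in
theorem exists_eval_eq_symmetrized_monomial {n : ℕ} (a b : ℕ) (hab : a + b < 2 * n) :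
    ∃ g : MvPolynomial (Fin 2) ℝ, g.totalDegree ≤ n - 1 ∧ ∀ x y : ℝ,
      eval ![2 * x * y, x ^ 2 + y ^ 2 - 1] g =
        x ^ a * y ^ b + y ^ a * x ^ b + ((-y) ^ a * (-x) ^ b + (-x) ^ a * (-y) ^ b) := by
  wlog hle : a ≤ b generalizing a b
  · obtain ⟨g, hg, hg'⟩ := this b a (by omega) (by omega)
    exact ⟨g, hg, fun x y => by rw [hg']; ring⟩
  obtain ⟨c, rfl⟩ := Nat.exists_eq_add_of_le hle
  rcases Nat.even_or_odd c with hc | hc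
  · obtain ⟨k, rfl⟩ := hc
    obtain ⟨p, hp, hp'⟩ := exists_eval_eq_pow_add_pow k
    refine ⟨C 2 * (C (1 / 2) * X 0) ^ a * p, ?_, fun x y => ?_⟩
    · have h₁ : (C (1 / 2) * X 0 : MvPolynomial (Fin 2) ℝ).totalDegree ≤ 1 :=
        (totalDegree_mul _ _).trans (by rw [totalDegree_C, totalDegree_X])
      have h₂ : (C 2 * (C (1 / 2) * X 0) ^ a : MvPolynomial (Fin 2) ℝ).totalDegree ≤ a := by
        refine (totalDegree_mul _ _).trans ?_
        rw [totalDegree_C, zero_add]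
        refine (totalDegree_pow _ _).trans ?_
        nlinarith
      exact (totalDegree_mul _ _).trans (by omega)
    · simp only [map_mul, hp', eval_X, eval_C, map_pow, Matrix.cons_val_zero]
      have e : ∀ u v : ℝ, u ^ a * v ^ (a + (k + k)) = (u * v) ^ a * (v ^ 2) ^ k := fun u v => by
        rw [mul_pow, ← pow_mul, pow_add]; ring
      rw [e, e, e, e, neg_mul_neg, neg_mul_neg, neg_sq, neg_sq,
        show 1 / 2 * (2 * x * y) = x * y by ring, mul_comm y x]
      ring
  · refine ⟨0, by simp, fun x y => ?_⟩
    have e : ∀ u v : ℝ, (-u) ^ a * (-v) ^ (a + c) = - (u ^ a * v ^ (a + c)) := fun u v => by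
      rw [pow_add, pow_add, hc.neg_pow, mul_neg, mul_neg, ← mul_assoc, ← mul_assoc, ← mul_pow,
        ← mul_pow, neg_mul_neg]
    rw [e, e]
    simp

open MvPolynomial in
theorem exists_eval_eq_symmetrized {n : ℕ} (hn : 1 ≤ n) (h : MvPolynomial (Fin 2) ℝ)
    (hdeg : h.totalDegree ≤ 2 * n - 1) :
    ∃ g : MvPolynomial (Fin 2) ℝ, g.totalDegree ≤ n - 1 ∧ ∀ x y : ℝ,
      eval ![2 * x * y, x ^ 2 + y ^ 2 - 1] g =
        eval ![x, y] h + eval ![y, x] h + (eval ![-y, -x] h + eval ![-x, -y] h) := by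
  have key : ∀ m : Fin 2 →₀ ℕ, ∃ g : MvPolynomial (Fin 2) ℝ, m ∈ h.support →
      g.totalDegree ≤ n - 1 ∧ ∀ x y : ℝ, eval ![2 * x * y, x ^ 2 + y ^ 2 - 1] g =
        x ^ m 0 * y ^ m 1 + y ^ m 0 * x ^ m 1 +
          ((-y) ^ m 0 * (-x) ^ m 1 + (-x) ^ m 0 * (-y) ^ m 1) := fun m => by
    by_cases hm : m ∈ h.support
    · have := le_totalDegree hm
      rw [Finsupp.sum_fintype _ _ (fun _ => rfl), Fin.sum_univ_two] at this
      obtain ⟨g, hg⟩ := exists_eval_eq_symmetrized_monomial (n := n) (m 0) (m 1) (by omega)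
      exact ⟨g, fun _ => hg⟩
    · exact ⟨0, fun hm' => absurd hm' hm⟩
  choose G hG using key
  refine ⟨∑ m ∈ h.support, C (h.coeff m) * G m, ?_, fun x y => ?_⟩
  · refine totalDegree_finsetSum_le fun m hm => (totalDegree_mul _ _).trans ?_
    rw [totalDegree_C, zero_add]
    exact (hG m hm).1
  · simp only [eval_eq_sum_fin_two _ _ h, ← Finset.sum_add_distrib, map_sum]
    refine Finset.sum_congr rfl fun m hm => ?_
    rw [map_mul, eval_C, (hG m hm).2]
    ring

theorem MeasureTheory.IntegrableOn.setIntegral_eq_of_involutive {α : Type*} [MeasurableSpace α]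
    {μ : Measure α} {σ : α ≃ᵐ α} (hσ : MeasurePreserving σ μ μ) (hinv : Function.Involutive σ)
    {S D : Set α} (hD : MeasurableSet D) (hdisj : Disjoint D (σ ⁻¹' D))
    (hS : S =ᵐ[μ] (D ∪ σ ⁻¹' D : Set α)) {f : α → ℝ} (hf : IntegrableOn f S μ) :
    IntegrableOn (fun x => f x + f (σ x)) D μ ∧
      ∫ x in S, f x ∂μ = ∫ x in D, f x + f (σ x) ∂μ := by
  have hf' := hf.congr_set_ae hS.symm
  have h₁ : IntegrableOn f D μ := hf'.mono_set subset_union_left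
  have h₂ : IntegrableOn f (σ ⁻¹' D) μ := hf'.mono_set subset_union_right
  have h₃ : IntegrableOn (fun x => f (σ x)) D μ := by
    rw [← hσ.integrableOn_comp_preimage σ.measurableEmbedding]
    simpa only [Function.comp_def, hinv _] using h₂
  refine ⟨h₁.add h₃, ?_⟩
  rw [setIntegral_congr_set hS, setIntegral_union hdisj (hσ.measurable hD) h₁ h₂,
    integral_add h₁ h₃, ← hσ.setIntegral_preimage_emb σ.measurableEmbedding (fun x => f (σ x))]
  simp only [hinv _]

/-- The part of the open square `(-1,1)²` below the diagonal. -/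
def lowerTriangle : Set (ℝ × ℝ) := Ioo (-1) 1 ×ˢ Ioo (-1) 1 ∩ {x | x.2 < x.1}

/-- The quarter of the open square `(-1,1)²` between its two diagonals, to the right of both. -/
def rightQuarter : Set (ℝ × ℝ) := lowerTriangle ∩ {x | 0 < x.1 + x.2}

/-- Reflection of the plane in the antidiagonal. -/
def negSwap : ℝ × ℝ ≃ᵐ ℝ × ℝ := MeasurableEquiv.prodComm.trans (MeasurableEquiv.neg (ℝ × ℝ))

@[simp]
theorem negSwap_apply (x : ℝ × ℝ) : negSwap x = (-x.2, -x.1) := rfl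

theorem measurableSet_lowerTriangle : MeasurableSet lowerTriangle :=
  (measurableSet_Ioo.prod measurableSet_Ioo).inter (measurableSet_lt measurable_snd measurable_fst)

theorem measurableSet_rightQuarter : MeasurableSet rightQuarter :=
  measurableSet_lowerTriangle.inter
    (measurableSet_lt measurable_const (measurable_fst.add measurable_snd))

theorem measurableEquiv_prodComm_apply (x : ℝ × ℝ) : MeasurableEquiv.prodComm x = x.swap := rfl

theorem measurePreserving_prodComm :
    MeasurePreserving (MeasurableEquiv.prodComm : ℝ × ℝ ≃ᵐ ℝ × ℝ) volume volume :=
  Measure.measurePreserving_swap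

theorem measurePreserving_negSwap : MeasurePreserving negSwap volume volume :=
  (Measure.measurePreserving_neg (volume : Measure (ℝ × ℝ))).comp measurePreserving_prodComm

theorem volume_ker_eq_zero {L : ℝ × ℝ →ₗ[ℝ] ℝ} (hL : L (1, 0) ≠ 0) :
    volume (LinearMap.ker L : Set (ℝ × ℝ)) = 0 := by
  refine Measure.addHaar_submodule _ _ fun h => hL ?_
  rw [LinearMap.ker_eq_top] at h
  simp [h]

theorem ae_fst_ne_snd : ∀ᵐ x : ℝ × ℝ, x.1 ≠ x.2 := by
  rw [ae_iff]
  convert volume_ker_eq_zero (L := LinearMap.fst ℝ ℝ ℝ - LinearMap.snd ℝ ℝ ℝ) (by simp) using 2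
  ext x
  simp [sub_eq_zero]

theorem ae_fst_add_snd_ne_zero : ∀ᵐ x : ℝ × ℝ, x.1 + x.2 ≠ 0 := by
  rw [ae_iff]
  convert volume_ker_eq_zero (L := LinearMap.fst ℝ ℝ ℝ + LinearMap.snd ℝ ℝ ℝ) (by simp) using 2
  ext x
  simp

theorem square_ae_eq_union :
    (Icc (-1 : ℝ) 1 ×ˢ Icc (-1 : ℝ) 1 : Set (ℝ × ℝ)) =ᵐ[volume]
      (lowerTriangle ∪ MeasurableEquiv.prodComm ⁻¹' lowerTriangle : Set (ℝ × ℝ)) := by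
  refine (Measure.set_prod_ae_eq Ioo_ae_eq_Icc Ioo_ae_eq_Icc).symm.trans ?_
  rw [Filter.eventuallyEq_set]
  filter_upwards [ae_fst_ne_snd] with x hx
  have := hx.lt_or_gt
  simp only [lowerTriangle, mem_union, mem_inter_iff, mem_prod, mem_preimage,
    measurableEquiv_prodComm_apply, Prod.fst_swap, Prod.snd_swap, mem_ofPred_eq]
  tauto

theorem lowerTriangle_ae_eq_union :
    lowerTriangle =ᵐ[volume] (rightQuarter ∪ negSwap ⁻¹' rightQuarter : Set (ℝ × ℝ)) := by
  rw [Filter.eventuallyEq_set]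
  filter_upwards [ae_fst_add_snd_ne_zero] with x hx
  have := hx.lt_or_gt
  simp only [lowerTriangle, rightQuarter, mem_union, mem_inter_iff, mem_prod, mem_preimage,
    negSwap_apply, mem_ofPred_eq, mem_Ioo]
  constructor
  · rintro ⟨⟨⟨h₁, h₂⟩, h₃, h₄⟩, h₅⟩
    rcases this with h | h
    · right; refine ⟨⟨⟨⟨?_, ?_⟩, ?_, ?_⟩, ?_⟩, ?_⟩ <;> linarith
    · left; exact ⟨⟨⟨⟨h₁, h₂⟩, h₃, h₄⟩, h₅⟩, h⟩
  · rintro (⟨h, -⟩ | ⟨⟨⟨⟨h₁, h₂⟩, h₃, h₄⟩, h₅⟩, -⟩)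
    · exact h
    · refine ⟨⟨⟨?_, ?_⟩, ?_, ?_⟩, ?_⟩ <;> linarith

theorem disjoint_lowerTriangle :
    Disjoint lowerTriangle (MeasurableEquiv.prodComm ⁻¹' lowerTriangle) :=
  Set.disjoint_left.2 fun x h h' => lt_asymm (show x.2 < x.1 from h.2) h'.2

theorem disjoint_rightQuarter : Disjoint rightQuarter (negSwap ⁻¹' rightQuarter) := by
  refine Set.disjoint_left.2 fun x h h' => ?_
  have h₁ : 0 < x.1 + x.2 := h.2
  have h₂ : 0 < -x.2 + -x.1 := h'.2
  linarith

theorem setIntegral_square_eq_lowerTriangle {f : ℝ × ℝ → ℝ}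
    (hf : IntegrableOn f (Icc (-1 : ℝ) 1 ×ˢ Icc (-1 : ℝ) 1)) :
    IntegrableOn (fun x => f x + f x.swap) lowerTriangle ∧
      ∫ x in Icc (-1 : ℝ) 1 ×ˢ Icc (-1 : ℝ) 1, f x = ∫ x in lowerTriangle, f x + f x.swap :=
  hf.setIntegral_eq_of_involutive measurePreserving_prodComm Prod.swap_swap
    measurableSet_lowerTriangle disjoint_lowerTriangle square_ae_eq_union

theorem setIntegral_square_eq_rightQuarter {f : ℝ × ℝ → ℝ}
    (hf : IntegrableOn f (Icc (-1 : ℝ) 1 ×ˢ Icc (-1 : ℝ) 1)) :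
    ∫ x in Icc (-1 : ℝ) 1 ×ˢ Icc (-1 : ℝ) 1, f x =
      ∫ x in rightQuarter, f x + f x.swap + (f (-x.2, -x.1) + f (-x.1, -x.2)) := by
  obtain ⟨h₁, h₂⟩ := setIntegral_square_eq_lowerTriangle hf
  rw [h₂]
  exact (h₁.setIntegral_eq_of_involutive measurePreserving_negSwap
    (fun x => by simp) measurableSet_rightQuarter disjoint_rightQuarter
    lowerTriangle_ae_eq_union).2

theorem setIntegral_lowerTriangle_eq_zero {F : ℝ × ℝ → ℝ} (hF : ∀ x, F x.swap = F x)
    (h : ∫ x in Icc (-1 : ℝ) 1 ×ˢ Icc (-1 : ℝ) 1, F x = 0) : ∫ x in lowerTriangle, F x = 0 := by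
  by_cases hi : IntegrableOn F lowerTriangle
  · have hi' : IntegrableOn F (MeasurableEquiv.prodComm ⁻¹' lowerTriangle) := by
      rw [← measurePreserving_prodComm.integrableOn_comp_preimage
        MeasurableEquiv.prodComm.measurableEmbedding] at hi
      simpa only [Function.comp_def, measurableEquiv_prodComm_apply, hF] using hi
    have := (setIntegral_square_eq_lowerTriangle
      ((hi.union hi').congr_set_ae square_ae_eq_union)).2
    simp only [hF, h, ← two_mul, integral_const_mul] at this
    linarith
  · exact integral_undef hi

/-- The map `(cos θ₁, cos θ₂) ↦ (cos (θ₁ - θ₂), cos (θ₁ + θ₂))`. -/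
def angleMap (x : ℝ × ℝ) : ℝ × ℝ :=
  (x.1 * x.2 + √(1 - x.1 ^ 2) * √(1 - x.2 ^ 2), x.1 * x.2 - √(1 - x.1 ^ 2) * √(1 - x.2 ^ 2))

/-- The derivative of `angleMap` on the open square. -/
def angleMapDeriv (x : ℝ × ℝ) : ℝ × ℝ →L[ℝ] ℝ × ℝ :=
  (Matrix.toLin (.finTwoProd ℝ) (.finTwoProd ℝ)
    !![x.2 - x.1 * √(1 - x.2 ^ 2) / √(1 - x.1 ^ 2), x.1 - x.2 * √(1 - x.1 ^ 2) / √(1 - x.2 ^ 2);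
      x.2 + x.1 * √(1 - x.2 ^ 2) / √(1 - x.1 ^ 2),
      x.1 + x.2 * √(1 - x.1 ^ 2) / √(1 - x.2 ^ 2)]).toContinuousLinearMap

theorem one_sub_sq_pos {t : ℝ} (ht : t ∈ Ioo (-1 : ℝ) 1) : 0 < 1 - t ^ 2 := by
  nlinarith [ht.1, ht.2]

theorem hasFDerivAt_angleMap {x : ℝ × ℝ} (h₁ : x.1 ∈ Ioo (-1 : ℝ) 1) (h₂ : x.2 ∈ Ioo (-1 : ℝ) 1) :
    HasFDerivAt angleMap (angleMapDeriv x) x := by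
  have hs : ∀ {t : ℝ}, t ∈ Ioo (-1 : ℝ) 1 →
      HasDerivAt (fun u : ℝ => √(1 - u ^ 2)) (-t / √(1 - t ^ 2)) t := fun {t} ht => by
    convert ((hasDerivAt_pow 2 t).const_sub 1).sqrt (one_sub_sq_pos ht).ne' using 1
    rw [← mul_div_mul_left (-t) _ two_ne_zero]
    simp
  have e₁ := (hs h₁).comp_hasFDerivAt x (hasFDerivAt_fst (𝕜 := ℝ) (E := ℝ) (F := ℝ) (p := x))
  have e₂ := (hs h₂).comp_hasFDerivAt x (hasFDerivAt_snd (𝕜 := ℝ) (E := ℝ) (F := ℝ) (p := x))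
  have e₃ := (hasFDerivAt_fst (𝕜 := ℝ) (E := ℝ) (F := ℝ) (p := x)).mul hasFDerivAt_snd
  refine ((e₃.add (e₁.mul e₂)).prodMk (e₃.sub (e₁.mul e₂))).congr_fderiv ?_
  ext <;> simp [angleMapDeriv] <;> ring

theorem abs_det_angleMapDeriv {x : ℝ × ℝ} (h₁ : x.1 ∈ Ioo (-1 : ℝ) 1)
    (h₂ : x.2 ∈ Ioo (-1 : ℝ) 1) :
    |(angleMapDeriv x).det| =
      2 * |x.1 ^ 2 - x.2 ^ 2| / (√(1 - x.1 ^ 2) * √(1 - x.2 ^ 2)) := by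
  have p₁ := Real.sqrt_pos.2 (one_sub_sq_pos h₁)
  have p₂ := Real.sqrt_pos.2 (one_sub_sq_pos h₂)
  have q₁ := Real.sq_sqrt (one_sub_sq_pos h₁).le
  have q₂ := Real.sq_sqrt (one_sub_sq_pos h₂).le
  have : (angleMapDeriv x).det =
      -(2 * (x.1 ^ 2 - x.2 ^ 2)) / (√(1 - x.1 ^ 2) * √(1 - x.2 ^ 2)) := by
    simp only [angleMapDeriv, LinearMap.det_toContinuousLinearMap, LinearMap.det_toLin,
      Matrix.det_fin_two_of]
    field_simp
    linear_combination 2 * x.2 ^ 2 * q₁ - 2 * x.1 ^ 2 * q₂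
  rw [this, abs_div, abs_neg, abs_mul, abs_two, abs_of_pos (mul_pos p₁ p₂)]

theorem angleMap_fst_add_snd (x : ℝ × ℝ) : (angleMap x).1 + (angleMap x).2 = 2 * x.1 * x.2 := by
  simp only [angleMap]; ring

theorem angleMap_fst_mul_snd {x : ℝ × ℝ} (h₁ : x.1 ∈ Ioo (-1 : ℝ) 1)
    (h₂ : x.2 ∈ Ioo (-1 : ℝ) 1) :
    (angleMap x).1 * (angleMap x).2 = x.1 ^ 2 + x.2 ^ 2 - 1 := by
  have q₁ := Real.sq_sqrt (one_sub_sq_pos h₁).le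
  have q₂ := Real.sq_sqrt (one_sub_sq_pos h₂).le
  simp only [angleMap]
  linear_combination - √(1 - x.2 ^ 2) ^ 2 * q₁ - (1 - x.1 ^ 2) * q₂

theorem injOn_angleMap : InjOn angleMap rightQuarter := by
  rintro x ⟨⟨⟨h₁, h₂⟩, h₃⟩, h₄⟩ y ⟨⟨⟨k₁, k₂⟩, k₃⟩, k₄⟩ hxy
  have e₁ := angleMap_fst_add_snd x
  have e₂ := angleMap_fst_mul_snd h₁ h₂
  rw [hxy, angleMap_fst_add_snd] at e₁
  rw [hxy, angleMap_fst_mul_snd k₁ k₂] at e₂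
  simp only [mem_ofPred_eq] at h₃ h₄ k₃ k₄
  have a₁ : x.1 + x.2 = y.1 + y.2 := (sq_eq_sq₀ h₄.le k₄.le).1 (by linear_combination -e₁ - e₂)
  have a₂ : x.1 - x.2 = y.1 - y.2 :=
    (sq_eq_sq₀ (by linarith) (by linarith)).1 (by linear_combination e₁ - e₂)
  ext <;> linarith

theorem image_angleMap : angleMap '' rightQuarter = lowerTriangle := by
  apply Subset.antisymm
  · rintro _ ⟨x, ⟨⟨⟨h₁, h₂⟩, h₃⟩, h₄⟩, rfl⟩
    simp only [mem_ofPred_eq] at h₃ h₄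
    have p : 0 < √(1 - x.1 ^ 2) * √(1 - x.2 ^ 2) :=
      mul_pos (Real.sqrt_pos.2 (one_sub_sq_pos h₁)) (Real.sqrt_pos.2 (one_sub_sq_pos h₂))
    have q : (√(1 - x.1 ^ 2) * √(1 - x.2 ^ 2)) ^ 2 = (1 - x.1 ^ 2) * (1 - x.2 ^ 2) := by
      rw [mul_pow, Real.sq_sqrt (one_sub_sq_pos h₁).le, Real.sq_sqrt (one_sub_sq_pos h₂).le]
    have b : |x.1 * x.2| < 1 := by
      rw [abs_mul]
      nlinarith [abs_lt.2 h₁, abs_lt.2 h₂, abs_nonneg x.1, abs_nonneg x.2]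
    rw [abs_lt] at b
    have c₁ : √(1 - x.1 ^ 2) * √(1 - x.2 ^ 2) < 1 - x.1 * x.2 :=
      lt_of_pow_lt_pow_left₀ 2 (by linarith) (by nlinarith)
    have c₂ : √(1 - x.1 ^ 2) * √(1 - x.2 ^ 2) < 1 + x.1 * x.2 :=
      lt_of_pow_lt_pow_left₀ 2 (by linarith) (by nlinarith)
    refine ⟨⟨⟨?_, ?_⟩, ?_, ?_⟩, ?_⟩ <;> simp only [angleMap, mem_ofPred_eq] <;> linarith
  · rintro ⟨u, v⟩ ⟨⟨⟨hu₁, hu₂⟩, hv₁, hv₂⟩, huv⟩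
    simp only [mem_ofPred_eq] at hu₁ hu₂ hv₁ hv₂ huv
    have pa : 0 < (1 + u) * (1 + v) := mul_pos (by linarith) (by linarith)
    have pb : 0 < (1 - u) * (1 - v) := mul_pos (by linarith) (by linarith)
    obtain ⟨a, ha, ha'⟩ : ∃ a : ℝ, 0 < a ∧ a ^ 2 = (1 + u) * (1 + v) :=
      ⟨_, Real.sqrt_pos.2 pa, Real.sq_sqrt pa.le⟩
    obtain ⟨b, hb, hb'⟩ : ∃ b : ℝ, 0 < b ∧ b ^ 2 = (1 - u) * (1 - v) :=
      ⟨_, Real.sqrt_pos.2 pb, Real.sq_sqrt pb.le⟩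
    have ca : a < 1 + (u + v) / 2 := lt_of_pow_lt_pow_left₀ 2 (by linarith) (by nlinarith)
    have cb : b < 1 - (u + v) / 2 := lt_of_pow_lt_pow_left₀ 2 (by linarith) (by nlinarith)
    have h₁ : (a + b) / 2 ∈ Ioo (-1 : ℝ) 1 := ⟨by linarith, by linarith⟩
    have h₂ : (a - b) / 2 ∈ Ioo (-1 : ℝ) 1 := ⟨by linarith, by linarith⟩
    refine ⟨((a + b) / 2, (a - b) / 2), ⟨⟨⟨h₁, h₂⟩, ?_⟩, ?_⟩, ?_⟩
    · simp only [mem_ofPred_eq]; linarith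
    · simp only [mem_ofPred_eq]; linarith
    · have e₂ : (a + b) / 2 * ((a - b) / 2) = (u + v) / 2 := by
        linear_combination ha' / 4 - hb' / 4
      have s : √(1 - ((a + b) / 2) ^ 2) * √(1 - ((a - b) / 2) ^ 2) = (u - v) / 2 := by
        rw [← Real.sqrt_mul (one_sub_sq_pos h₁).le, Real.sqrt_eq_iff_mul_self_eq
          (mul_pos (one_sub_sq_pos h₁) (one_sub_sq_pos h₂)).le (by linarith)]
        have e₁ : ((a + b) / 2) ^ 2 + ((a - b) / 2) ^ 2 = 1 + u * v := by
          linear_combination ha' / 2 + hb' / 2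
        linear_combination ((a + b) / 2 * ((a - b) / 2) + (u + v) / 2) * e₂ - e₁
      simp only [angleMap, s, e₂]
      ext <;> simp <;> ring

theorem Wsq_swap (w : ℝ → ℝ) (γ : ℝ) (x : ℝ × ℝ) : Wsq w γ x.swap = Wsq w γ x := by
  simp only [Wsq, Prod.fst_swap, Prod.snd_swap]
  rw [← neg_sub (Real.arccos x.1), Real.cos_neg, add_comm, abs_sub_comm]
  ring

theorem Wsq_neg (w : ℝ → ℝ) (γ : ℝ) (x : ℝ × ℝ) : Wsq w γ (-x.1, -x.2) = Wsq w γ x := by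
  simp only [Wsq, Real.arccos_neg, neg_sq]
  rw [show Real.pi - Real.arccos x.1 - (Real.pi - Real.arccos x.2) =
      -(Real.arccos x.1 - Real.arccos x.2) by ring,
    show Real.pi - Real.arccos x.1 + (Real.pi - Real.arccos x.2) =
      2 * Real.pi - (Real.arccos x.1 + Real.arccos x.2) by ring, Real.cos_neg,
    Real.cos_two_pi_sub]

theorem Wsq_negSwap (w : ℝ → ℝ) (γ : ℝ) (x : ℝ × ℝ) : Wsq w γ (-x.2, -x.1) = Wsq w γ x := by
  rw [← Wsq_swap w γ x, ← Wsq_neg w γ x.swap, Prod.fst_swap, Prod.snd_swap]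

theorem Wsq_eq_abs_det_mul (w : ℝ → ℝ) (γ : ℝ) {x : ℝ × ℝ} (h₁ : x.1 ∈ Ioo (-1 : ℝ) 1)
    (h₂ : x.2 ∈ Ioo (-1 : ℝ) 1) :
    Wsq w γ x = ((2 : ℝ) ^ (2 * γ + 2))⁻¹ * (|(angleMapDeriv x).det| *
      (w (angleMap x).1 * w (angleMap x).2 *
        |(angleMap x).1 - (angleMap x).2| ^ (2 * γ + 1))) := by
  rw [abs_det_angleMapDeriv h₁ h₂]
  have p₁ := Real.sqrt_pos.2 (one_sub_sq_pos h₁)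
  have p₂ := Real.sqrt_pos.2 (one_sub_sq_pos h₂)
  have hpow : ∀ {t : ℝ}, t ∈ Ioo (-1 : ℝ) 1 → (1 - t ^ 2) ^ γ = √(1 - t ^ 2) ^ (2 * γ) :=
    fun {t} ht => by
      rw [Real.rpow_mul (Real.sqrt_nonneg _), Real.rpow_two, Real.sq_sqrt (one_sub_sq_pos ht).le]
  simp only [Wsq, angleMap, Real.cos_sub, Real.cos_add, Real.sin_arccos,
    Real.cos_arccos h₁.1.le h₁.2.le, Real.cos_arccos h₂.1.le h₂.2.le, hpow h₁, hpow h₂]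
  set s := √(1 - x.1 ^ 2)
  set t := √(1 - x.2 ^ 2)
  have hd : |x.1 * x.2 + s * t - (x.1 * x.2 - s * t)| = 2 * (s * t) := by
    rw [abs_of_pos] <;> nlinarith [mul_pos p₁ p₂]
  have h2 : (0 : ℝ) < 2 ^ (2 * γ) := Real.rpow_pos_of_pos two_pos _
  rw [hd, Real.mul_rpow zero_le_two (mul_pos p₁ p₂).le, Real.rpow_add (mul_pos p₁ p₂),
    Real.rpow_add two_pos, Real.rpow_add two_pos, Real.rpow_one, Real.rpow_one,
    Real.mul_rpow p₁.le p₂.le, Real.rpow_two]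
  field_simp

theorem setIntegral_rightQuarter_comp_angleMap (w : ℝ → ℝ) (γ : ℝ) (F : ℝ × ℝ → ℝ) :
    ∫ x in rightQuarter, F (angleMap x) * Wsq w γ x =
      ((2 : ℝ) ^ (2 * γ + 2))⁻¹ *
        ∫ y in lowerTriangle, F y * (w y.1 * w y.2 * |y.1 - y.2| ^ (2 * γ + 1)) := by
  rw [← image_angleMap, integral_image_eq_integral_abs_det_fderiv_smul volume
    measurableSet_rightQuarter (fun x hx =>
      (hasFDerivAt_angleMap hx.1.1.1 hx.1.1.2).hasFDerivWithinAt) injOn_angleMap,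
    ← integral_const_mul]
  refine setIntegral_congr_fun measurableSet_rightQuarter fun x hx => ?_
  simp only [Wsq_eq_abs_det_mul w γ hx.1.1.1 hx.1.1.2, smul_eq_mul]
  ring

theorem stmt9 (w : ℝ → ℝ)
    (hw_nonneg : ∀ t ∈ Icc (-1:ℝ) 1, 0 ≤ w t)
    (hw_int : IntegrableOn w (Icc (-1:ℝ) 1))
    (hw_ne : ¬ (w =ᵐ[volume.restrict (Icc (-1:ℝ) 1)] 0))
    (γ : ℝ) (hγ : -1/2 ≤ γ)
    (n : ℕ) (hn : 1 ≤ n)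
    (P : MvPolynomial (Fin 2) ℝ) (hPdeg : P.totalDegree ≤ n)
    (hPorth : ∀ g : MvPolynomial (Fin 2) ℝ, g.totalDegree ≤ n - 1 →
      (∫ y in (Icc (-1:ℝ) 1) ×ˢ (Icc (-1:ℝ) 1),
        MvPolynomial.eval ![y.1 + y.2, y.1 * y.2] P *
          MvPolynomial.eval ![y.1 + y.2, y.1 * y.2] g *
          (w y.1 * w y.2 * |y.1 - y.2| ^ (2*γ+1))) = 0) :
    ∃ Q : MvPolynomial (Fin 2) ℝ, Q.totalDegree ≤ 2*n ∧
      (∀ x₁ x₂ : ℝ, MvPolynomial.eval ![x₁, x₂] Q =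
        MvPolynomial.eval ![2 * x₁ * x₂, x₁ ^ 2 + x₂ ^ 2 - 1] P) ∧
      (∀ h : MvPolynomial (Fin 2) ℝ, h.totalDegree ≤ 2*n - 1 →
        (∫ x in (Icc (-1:ℝ) 1) ×ˢ (Icc (-1:ℝ) 1),
          MvPolynomial.eval ![x.1, x.2] Q * MvPolynomial.eval ![x.1, x.2] h *
            Wsq w γ x) = 0) := by
  have hQ : ∀ x₁ x₂ : ℝ, MvPolynomial.eval ![x₁, x₂] (MvPolynomial.aeval
      ![MvPolynomial.C 2 * MvPolynomial.X 0 * MvPolynomial.X 1,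
        MvPolynomial.X 0 ^ 2 + MvPolynomial.X 1 ^ 2 - MvPolynomial.C 1] P) =
      MvPolynomial.eval ![2 * x₁ * x₂, x₁ ^ 2 + x₂ ^ 2 - 1] P := fun x₁ x₂ => by
    rw [MvPolynomial.aeval_def, MvPolynomial.eval₂_eq', MvPolynomial.eval_eq_sum_fin_two _ _ P]
    simp [Fin.prod_univ_two]
  refine ⟨_, ?_, hQ, fun h hh => ?_⟩
  · refine (MvPolynomial.totalDegree_aeval_le (d := 2) (fun i => ?_) P).trans (by omega)
    fin_cases i
    · refine (MvPolynomial.totalDegree_mul _ _).trans ?_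
      refine (Nat.add_le_add_right (MvPolynomial.totalDegree_mul _ _) _).trans ?_
      simp
    · refine (MvPolynomial.totalDegree_sub_C_le _ _).trans ?_
      exact (MvPolynomial.totalDegree_add _ _).trans (by simp)
  · simp only [hQ]
    obtain ⟨g, hg, hg'⟩ := exists_eval_eq_symmetrized hn h hh
    by_cases hi : IntegrableOn (fun x : ℝ × ℝ =>
        MvPolynomial.eval ![2 * x.1 * x.2, x.1 ^ 2 + x.2 ^ 2 - 1] P *
          MvPolynomial.eval ![x.1, x.2] h * Wsq w γ x) (Icc (-1 : ℝ) 1 ×ˢ Icc (-1 : ℝ) 1)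
    swap
    · exact integral_undef hi
    rw [setIntegral_square_eq_rightQuarter hi]
    set F : ℝ × ℝ → ℝ := fun y => MvPolynomial.eval ![y.1 + y.2, y.1 * y.2] P *
      MvPolynomial.eval ![y.1 + y.2, y.1 * y.2] g with hF
    have hzero : ∫ y in lowerTriangle, F y * (w y.1 * w y.2 * |y.1 - y.2| ^ (2 * γ + 1)) = 0 := by
      refine setIntegral_lowerTriangle_eq_zero (fun y => ?_) (hPorth g hg)
      simp only [hF, Prod.fst_swap, Prod.snd_swap]
      rw [add_comm y.2, mul_comm y.2, abs_sub_comm, mul_comm (w y.2)]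
    have hcov := setIntegral_rightQuarter_comp_angleMap w γ F
    rw [hzero, mul_zero] at hcov
    rw [← hcov]
    refine setIntegral_congr_fun measurableSet_rightQuarter fun x hx => ?_
    simp only [hF, angleMap_fst_add_snd, angleMap_fst_mul_snd hx.1.1.1 hx.1.1.2, hg',
      Wsq_swap, Wsq_neg, Wsq_negSwap, Prod.fst_swap, Prod.snd_swap, neg_sq]
    rw [show 2 * x.2 * x.1 = 2 * x.1 * x.2 by ring, show 2 * -x.2 * -x.1 = 2 * x.1 * x.2 by ring,
      show 2 * -x.1 * -x.2 = 2 * x.1 * x.2 by ring, add_comm (x.2 ^ 2)]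
    ring


end
end
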